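/- For every s ≥ 1: max K(b^s,1,2) + max K(c^s,1,1) > min K(b^s,1,1) + min K(c^s,1,2). Consequently, the Minkowski sum (K(b^s,1,1) ∪ K(b^s,1,2)) + K(c^s,1) is exactly the closed interval [ [0; b^s, 1, 1, \overline{3,1}] + [0; c^s, 1, \overline{1,3}] , [0; b^s, 1, 2, \overline{1,3}] + [0; c^s, 1, \overline{3,1}] ]. -/

import Mathlib

open Filter Set
open scoped Pointwise

noncomputable section

/-- The `n`-th convergent of the continued fraction `[0; a 0, a 1, a 2, …]`. -/
def cfConv : ℕ → (ℕ → ℕ) → ℝ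
  | 0, _ => 0
  | n + 1, a => 1 / (a 0 + cfConv n fun i => a (i + 1))

/-- The value `[0; a 0, a 1, a 2, …]` of the infinite continued fraction with
partial quotients `a 0, a 1, …` (the limit of its convergents). -/
def cfVal (a : ℕ → ℕ) : ℝ := limUnder atTop fun n => cfConv n a

/-- The sequence of partial quotients obtained by concatenating the finite word `b`
with the sequence `θ`. -/
def app (b : List ℕ) (θ : ℕ → ℕ) : ℕ → ℕ := fun n =>
  if h : n < b.length then b.get ⟨n, h⟩ else θ (n - b.length)

/-- The forbidden pairs of consecutive partial quotients. -/
def badPairs : Set (ℕ × ℕ) := {(1, 4), (2, 4)}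

/-- The set `D` of sequences with entries in `{1,2,3,4}` avoiding the pairs
`(1,4)` and `(2,4)`. -/
def Dset : Set (ℕ → ℕ) :=
  {θ | (∀ n, θ n ∈ ({1, 2, 3, 4} : Set ℕ)) ∧ ∀ n, (θ n, θ (n + 1)) ∉ badPairs}

/-- The Cantor set `K(b) = {[0; b, θ] : θ ∈ D, (b_s, θ_1) ∉ {(1,4),(2,4)}}`. -/
def Kb (b : List ℕ) : Set ℝ :=
  {x | ∃ θ ∈ Dset, (∀ d, b.getLast? = some d → (d, θ 0) ∉ badPairs) ∧
    x = cfVal (app b θ)}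

/-- The set `K̃(b) ⊆ K(b)` of values `[0; b, θ]` with moreover `(θ_1, θ_2) ≠ (1,3)`. -/
def Ktil (b : List ℕ) : Set ℝ :=
  {x | ∃ θ ∈ Dset, (∀ d, b.getLast? = some d → (d, θ 0) ∉ badPairs) ∧
    (θ 0, θ 1) ≠ (1, 3) ∧ x = cfVal (app b θ)}

/-- The word `b^s = (1,4)_s`. -/
def bW (s : ℕ) : List ℕ := (List.replicate s [1, 4]).flatten

/-- The word `c^s = (1,4)_{s-1}, 1, 3`. -/
def cW (s : ℕ) : List ℕ := bW (s - 1) ++ [1, 3]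

/-- The periodic sequence `\overline{1,3}`. -/
def per13 : ℕ → ℕ := fun n => if n % 2 = 0 then 1 else 3

/-- The periodic sequence `\overline{3,1}`. -/
def per31 : ℕ → ℕ := fun n => if n % 2 = 0 then 3 else 1

/-! ### Convergence of continued fractions -/

/-- The action of a finite word on a tail: `cfWord b x = [0; b, 1/x]` in the sense that
`cfWord [b₁, …, bₛ] x = 1/(b₁ + 1/(b₂ + ⋯ + 1/(bₛ + x)))`. -/
def cfWord (w : List ℕ) (x : ℝ) : ℝ := w.foldr (fun a y => 1 / ((a : ℝ) + y)) x

theorem cfWord_nil (x : ℝ) : cfWord [] x = x := rfl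

theorem cfWord_cons (a : ℕ) (w : List ℕ) (x : ℝ) :
    cfWord (a :: w) x = 1 / ((a : ℝ) + cfWord w x) := rfl

theorem cfWord_append (v w : List ℕ) (x : ℝ) :
    cfWord (v ++ w) x = cfWord v (cfWord w x) := by
  simp [cfWord, List.foldr_append]

theorem cfConv_mem_Icc (n : ℕ) : ∀ a : ℕ → ℕ, (∀ i, 1 ≤ a i) → cfConv n a ∈ Icc (0 : ℝ) 1 := by
  induction n with
  | zero => intro a _; simp [cfConv]
  | succ n ih =>
    intro a ha
    obtain ⟨h0, -⟩ := ih (fun i => a (i + 1)) (fun i => ha _)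
    have h1 : (1 : ℝ) ≤ a 0 := by exact_mod_cast ha 0
    refine ⟨by simp only [cfConv]; positivity, ?_⟩
    simp only [cfConv]
    rw [div_le_one (by positivity)]
    linarith

theorem one_div_add_sub_le {a x y d : ℝ} (ha : 1 ≤ a) (hx : 0 ≤ x) (hxy : x ≤ y)
    (hd : y - x ≤ d) : 1 / (a + x) - 1 / (a + y) ≤ d / (1 + d) := by
  have hd0 : 0 ≤ d := by linarith
  rw [div_sub_div _ _ (by positivity) (by linarith), div_le_div_iff₀ (by nlinarith) (by positivity)]
  have h1 : 0 ≤ a * a - 1 := by nlinarith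
  have h2 : 0 ≤ x * (a + y) := by nlinarith
  nlinarith [mul_nonneg hd0 h1, mul_nonneg hd0 h2, mul_nonneg hd0 (sub_nonneg.2 ha),
    mul_nonneg (mul_nonneg hd0 (sub_nonneg.2 ha)) (hx.trans hxy)]

theorem abs_one_div_add_sub_le {a x y d : ℝ} (ha : 1 ≤ a) (hx : 0 ≤ x) (hy : 0 ≤ y)
    (hd : |x - y| ≤ d) : |1 / (a + x) - 1 / (a + y)| ≤ d / (1 + d) := by
  rcases le_total x y with h | h
  · rw [abs_of_nonneg (sub_nonneg.2 (one_div_le_one_div_of_le (by linarith) (by linarith)))]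
    exact one_div_add_sub_le ha hx h (by rw [abs_sub_comm] at hd; exact (le_abs_self _).trans hd)
  · rw [abs_sub_comm,
      abs_of_nonneg (sub_nonneg.2 (one_div_le_one_div_of_le (by linarith) (by linarith)))]
    exact one_div_add_sub_le ha hy h ((le_abs_self _).trans hd)

theorem abs_cfConv_sub_le (k : ℕ) : ∀ (a b : ℕ → ℕ) (n m : ℕ), (∀ i, 1 ≤ a i) → (∀ i, 1 ≤ b i) →
    (∀ i < k, a i = b i) → k ≤ n → k ≤ m → |cfConv n a - cfConv m b| ≤ 1 / ((k : ℝ) + 1) := by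
  induction k with
  | zero =>
    intro a b n m ha hb _ _ _
    have h1 := cfConv_mem_Icc n a ha
    have h2 := cfConv_mem_Icc m b hb
    rw [abs_le]
    norm_num
    constructor <;> linarith [h1.1, h1.2, h2.1, h2.2]
  | succ k ih =>
    intro a b n m ha hb hab hn hm
    obtain ⟨n, rfl⟩ : ∃ n', n = n' + 1 := ⟨n - 1, by omega⟩
    obtain ⟨m, rfl⟩ : ∃ m', m = m' + 1 := ⟨m - 1, by omega⟩
    have h := ih (fun i => a (i + 1)) (fun i => b (i + 1)) n m (fun i => ha _) (fun i => hb _)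
      (fun i hi => hab _ (by omega)) (by omega) (by omega)
    have h1 : (1 : ℝ) ≤ a 0 := by exact_mod_cast ha 0
    simp only [cfConv, ← hab 0 (by omega)]
    refine (abs_one_div_add_sub_le h1 (cfConv_mem_Icc n _ fun i => ha _).1
      (cfConv_mem_Icc m _ fun i => hb _).1 h).trans (le_of_eq ?_)
    push_cast
    field_simp

theorem tendsto_cfConv {a : ℕ → ℕ} (ha : ∀ i, 1 ≤ a i) :
    Tendsto (fun n => cfConv n a) atTop (nhds (cfVal a)) := by
  refine tendsto_nhds_limUnder <| cauchySeq_tendsto_of_complete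
    (cauchySeq_of_le_tendsto_0 (fun k : ℕ => 1 / ((k : ℝ) + 1)) ?_
    tendsto_one_div_add_atTop_nhds_zero_nat)
  intro n m k hn hm
  exact abs_cfConv_sub_le k a a n m ha ha (fun _ _ => rfl) hn hm

theorem abs_cfVal_sub_le {a b : ℕ → ℕ} (ha : ∀ i, 1 ≤ a i) (hb : ∀ i, 1 ≤ b i) {k : ℕ}
    (hab : ∀ i < k, a i = b i) : |cfVal a - cfVal b| ≤ 1 / ((k : ℝ) + 1) := by
  refine le_of_tendsto ((tendsto_cfConv ha).sub (tendsto_cfConv hb)).abs ?_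
  filter_upwards [eventually_ge_atTop k] with n hn
  exact abs_cfConv_sub_le k a b n n ha hb hab hn hn

theorem cfVal_mem_Icc {a : ℕ → ℕ} (ha : ∀ i, 1 ≤ a i) : cfVal a ∈ Icc (0 : ℝ) 1 :=
  isClosed_Icc.mem_of_tendsto (tendsto_cfConv ha)
    (Eventually.of_forall fun n => cfConv_mem_Icc n a ha)

theorem cfVal_eq {a : ℕ → ℕ} (ha : ∀ i, 1 ≤ a i) :
    cfVal a = 1 / ((a 0 : ℝ) + cfVal fun i => a (i + 1)) := by
  have h1 : (1 : ℝ) ≤ a 0 := by exact_mod_cast ha 0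
  have h2 := (cfVal_mem_Icc (a := fun i => a (i + 1)) fun i => ha _).1
  refine tendsto_nhds_unique ((tendsto_add_atTop_iff_nat 1).2 (tendsto_cfConv ha)) ?_
  simp only [cfConv]
  exact tendsto_const_nhds.div
    ((tendsto_cfConv (a := fun i => a (i + 1)) fun i => ha _).const_add _) (by positivity)

/-! ### Concatenation -/

theorem app_nil (θ : ℕ → ℕ) : app [] θ = θ := by
  funext n; simp [app]

theorem app_cons_zero (a : ℕ) (w : List ℕ) (θ : ℕ → ℕ) : app (a :: w) θ 0 = a := by
  simp [app]

theorem app_cons_succ (a : ℕ) (w : List ℕ) (θ : ℕ → ℕ) (n : ℕ) :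
    app (a :: w) θ (n + 1) = app w θ n := by
  simp [app]

theorem app_append (v w : List ℕ) (θ : ℕ → ℕ) : app (v ++ w) θ = app v (app w θ) := by
  induction v with
  | nil => simp [app_nil]
  | cons a v ih =>
    funext n
    cases n with
    | zero => simp only [List.cons_append, app_cons_zero]
    | succ n => simp only [List.cons_append, app_cons_succ, ih]

theorem one_le_app {w : List ℕ} (hw : ∀ a ∈ w, 1 ≤ a) {θ : ℕ → ℕ} (hθ : ∀ i, 1 ≤ θ i) (n : ℕ) :
    1 ≤ app w θ n := by
  unfold app
  split_ifs with h
  · exact hw _ (List.getElem_mem h)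
  · exact hθ _

theorem cfVal_app {w : List ℕ} (hw : ∀ a ∈ w, 1 ≤ a) {θ : ℕ → ℕ} (hθ : ∀ i, 1 ≤ θ i) :
    cfVal (app w θ) = cfWord w (cfVal θ) := by
  induction w with
  | nil => rw [app_nil, cfWord_nil]
  | cons a w ih =>
    rw [cfVal_eq (one_le_app hw hθ), cfWord_cons, app_cons_zero]
    simp only [app_cons_succ]
    rw [ih fun b hb => hw b (List.mem_cons_of_mem _ hb)]

theorem one_le_of_mem_Dset {θ : ℕ → ℕ} (hθ : θ ∈ Dset) (i : ℕ) : 1 ≤ θ i := by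
  have := hθ.1 i
  simp only [mem_insert_iff, mem_singleton_iff] at this
  omega

theorem app_singleton_mem_Dset {j : ℕ} {θ : ℕ → ℕ} (hθ : θ ∈ Dset)
    (hj : j ∈ ({1, 2, 3, 4} : Set ℕ)) (h : (j, θ 0) ∉ badPairs) : app [j] θ ∈ Dset := by
  refine ⟨fun n => ?_, fun n => ?_⟩
  · cases n with
    | zero => rwa [app_cons_zero]
    | succ n => rw [app_cons_succ, app_nil]; exact hθ.1 n
  · cases n with
    | zero => rwa [app_cons_zero, app_cons_succ, app_nil]
    | succ n => simp only [app_cons_succ, app_nil]; exact hθ.2 n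

/-! ### Möbius maps attached to words -/

theorem cfWord_mobius {w : List ℕ} (hw : ∀ a ∈ w, 1 ≤ a) : ∃ p p' u v : ℝ, 0 ≤ p ∧ 0 ≤ p' ∧
    0 < u ∧ 0 ≤ v ∧ p' * u - p * v = (-1) ^ w.length ∧
    ∀ x, 0 ≤ x → cfWord w x = (p + p' * x) / (u + v * x) := by
  induction w with
  | nil => exact ⟨0, 1, 1, 0, by simp [cfWord]⟩
  | cons a w ih =>
    obtain ⟨p, p', u, v, hp, hp', hu, hv, hdet, h⟩ := ih fun b hb => hw b (List.mem_cons_of_mem _ hb)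
    have ha : (1 : ℝ) ≤ a := by exact_mod_cast hw a List.mem_cons_self
    refine ⟨u, v, a * u + p, a * v + p', hu.le, hv, by positivity, by positivity, ?_, ?_⟩
    · rw [List.length_cons, pow_succ, ← hdet]; ring
    · intro x hx
      rw [cfWord_cons, h x hx]
      have : 0 < u + v * x := by positivity
      field_simp
      ring

theorem cfWord_sub {w : List ℕ} (hw : ∀ a ∈ w, 1 ≤ a) : ∃ u v : ℝ, 0 < u ∧ 0 ≤ v ∧
    ∀ x y, 0 ≤ x → 0 ≤ y →
      cfWord w y - cfWord w x = (-1) ^ w.length * ((y - x) / ((u + v * x) * (u + v * y))) := by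
  obtain ⟨p, p', u, v, -, -, hu, hv, hdet, h⟩ := cfWord_mobius hw
  refine ⟨u, v, hu, hv, fun x y hx hy => ?_⟩
  have h1 : 0 < u + v * x := by positivity
  have h2 : 0 < u + v * y := by positivity
  rw [h x hx, h y hy, ← hdet]
  field_simp
  ring

theorem cfWord_mono {w : List ℕ} (hw : ∀ a ∈ w, 1 ≤ a) (he : Even w.length) {x y : ℝ}
    (hx : 0 ≤ x) (hxy : x ≤ y) : cfWord w x ≤ cfWord w y := by
  obtain ⟨u, v, hu, hv, h⟩ := cfWord_sub hw
  have hy := hx.trans hxy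
  have h1 : 0 ≤ (y - x) / ((u + v * x) * (u + v * y)) :=
    div_nonneg (by linarith) (by positivity)
  have := h x y hx hy
  rw [he.neg_one_pow] at this
  linarith

theorem cfWord_anti {w : List ℕ} (hw : ∀ a ∈ w, 1 ≤ a) (ho : Odd w.length) {x y : ℝ}
    (hx : 0 ≤ x) (hxy : x ≤ y) : cfWord w y ≤ cfWord w x := by
  obtain ⟨u, v, hu, hv, h⟩ := cfWord_sub hw
  have hy := hx.trans hxy
  have h1 : 0 ≤ (y - x) / ((u + v * x) * (u + v * y)) :=
    div_nonneg (by linarith) (by positivity)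
  have := h x y hx hy
  rw [ho.neg_one_pow] at this
  linarith

theorem cfWord_strictMono {w : List ℕ} (hw : ∀ a ∈ w, 1 ≤ a) (he : Even w.length) {x y : ℝ}
    (hx : 0 ≤ x) (hxy : x < y) : cfWord w x < cfWord w y := by
  obtain ⟨u, v, hu, hv, h⟩ := cfWord_sub hw
  have hy := hx.trans hxy.le
  have h1 : 0 < (y - x) / ((u + v * x) * (u + v * y)) :=
    div_pos (by linarith) (by positivity)
  have := h x y hx hy
  rw [he.neg_one_pow] at this
  linarith

theorem abs_cfWord_sub_le {w : List ℕ} (hw : ∀ a ∈ w, 1 ≤ a) {c x y x' y' : ℝ}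
    (hx : 0 ≤ x) (hxy : x ≤ y) (hx' : 0 ≤ x') (hxy' : x' ≤ y')
    (h₀ : y' - x' ≤ c * (y - x)) (h₁ : (y' - x') * (x + y) ≤ c * (y - x) * (x' + y'))
    (h₂ : (y' - x') * (x * y) ≤ c * (y - x) * (x' * y')) :
    |cfWord w y' - cfWord w x'| ≤ c * |cfWord w y - cfWord w x| := by
  obtain ⟨u, v, hu, hv, h⟩ := cfWord_sub hw
  have hy := hx.trans hxy
  have hy' := hx'.trans hxy'
  rw [h x y hx hy, h x' y' hx' hy', abs_mul, abs_mul, abs_pow, abs_neg, abs_one, one_pow, one_mul,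
    one_mul, abs_of_nonneg (div_nonneg (sub_nonneg.2 hxy) (by positivity)),
    abs_of_nonneg (div_nonneg (sub_nonneg.2 hxy') (by positivity)), ← mul_div_assoc,
    div_le_div_iff₀ (by positivity) (by positivity)]
  nlinarith [mul_le_mul_of_nonneg_left h₀ (mul_nonneg hu.le hu.le),
    mul_le_mul_of_nonneg_left h₁ (mul_nonneg hu.le hv),
    mul_le_mul_of_nonneg_left h₂ (mul_nonneg hv hv)]

/-- `x` is within `10⁻⁶` of `x₀`. -/
def Near (x x₀ : ℝ) : Prop := x₀ - 1 / 10 ^ 6 ≤ x ∧ x ≤ x₀ + 1 / 10 ^ 6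

theorem abs_cfWord_sub_le_of_near {w : List ℕ} (hw : ∀ a ∈ w, 1 ≤ a) {x y x' y' : ℝ}
    (c x₀ y₀ x₀' y₀' : ℝ) (hx : Near x x₀) (hy : Near y y₀) (hx' : Near x' x₀') (hy' : Near y' y₀')
    (hpos : 0 ≤ c ∧ 1 / 10 ^ 6 ≤ x₀ ∧ x₀ + 2 / 10 ^ 6 ≤ y₀ ∧ 1 / 10 ^ 6 ≤ x₀' ∧
      x₀' + 2 / 10 ^ 6 ≤ y₀')
    (hnum : y₀' - x₀' + 2 / 10 ^ 6 ≤ c * (y₀ - x₀ - 2 / 10 ^ 6) ∧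
      (y₀' - x₀' + 2 / 10 ^ 6) * (x₀ + y₀ + 2 / 10 ^ 6) ≤
        c * (y₀ - x₀ - 2 / 10 ^ 6) * (x₀' + y₀' - 2 / 10 ^ 6) ∧
      (y₀' - x₀' + 2 / 10 ^ 6) * ((x₀ + 1 / 10 ^ 6) * (y₀ + 1 / 10 ^ 6)) ≤
        c * (y₀ - x₀ - 2 / 10 ^ 6) * ((x₀' - 1 / 10 ^ 6) * (y₀' - 1 / 10 ^ 6))) :
    |cfWord w y' - cfWord w x'| ≤ c * |cfWord w y - cfWord w x| := by
  obtain ⟨hc, h1, h2, h3, h4⟩ := hpos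
  obtain ⟨n0, n1, n2⟩ := hnum
  obtain ⟨a1, a2⟩ := hx
  obtain ⟨b1, b2⟩ := hy
  obtain ⟨c1, c2⟩ := hx'
  obtain ⟨d1, d2⟩ := hy'
  have hx0 : 0 ≤ x := by linarith
  have hy0 : 0 ≤ y := by linarith
  have hx0' : 0 ≤ x' := by linarith
  have hy0' : 0 ≤ y' := by linarith
  have e1 : y' - x' ≤ y₀' - x₀' + 2 / 10 ^ 6 := by linarith
  have e2 : y₀ - x₀ - 2 / 10 ^ 6 ≤ y - x := by linarith
  have e3 : c * (y₀ - x₀ - 2 / 10 ^ 6) ≤ c * (y - x) := by gcongr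
  have e4 : 0 ≤ y' - x' := by linarith
  have e5 : 0 ≤ c * (y₀ - x₀ - 2 / 10 ^ 6) := mul_nonneg hc (by linarith)
  refine abs_cfWord_sub_le hw hx0 (by linarith) hx0' (by linarith) (by linarith) ?_ ?_
  · refine le_trans ?_ (n1.trans ?_)
    · exact mul_le_mul e1 (by linarith) (by linarith) (by linarith)
    · exact mul_le_mul e3 (by linarith) (by linarith) (e5.trans e3)
  · refine le_trans ?_ (n2.trans ?_)
    · exact mul_le_mul e1 (mul_le_mul a2 b2 hy0 (by linarith)) (by positivity) (by linarith)
    · exact mul_le_mul e3 (mul_le_mul c1 d1 (by linarith) hx0')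
        (mul_nonneg (by linarith) (by linarith)) (e5.trans e3)

/-! ### Extremal tails -/

theorem per13_mem : per13 ∈ Dset := by
  refine ⟨fun n => ?_, fun n => ?_⟩ <;> simp only [per13, badPairs] <;> split_ifs <;> simp

theorem per31_mem : per31 ∈ Dset := by
  refine ⟨fun n => ?_, fun n => ?_⟩ <;> simp only [per31, badPairs] <;> split_ifs <;> simp

/-- The value `[0; \overline{1,3}]`. -/
def phi : ℝ := cfVal per13

theorem phi_eq : phi = 1 / (1 + cfVal per31) := by
  have h : (fun i => per13 (i + 1)) = per31 := by
    funext i; simp only [per13, per31]; split_ifs <;> first | rfl | omega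
  rw [phi, cfVal_eq (one_le_of_mem_Dset per13_mem), h]
  simp [per13]

theorem cfVal_per31_eq : cfVal per31 = 1 / (3 + phi) := by
  have h : (fun i => per31 (i + 1)) = per13 := by
    funext i; simp only [per13, per31]; split_ifs <;> first | rfl | omega
  rw [phi, cfVal_eq (one_le_of_mem_Dset per31_mem), h]
  simp [per31]

theorem phi_nonneg : 0 ≤ phi := (cfVal_mem_Icc (one_le_of_mem_Dset per13_mem)).1

theorem phi_sq : phi ^ 2 = 3 - 3 * phi := by
  have h1 := phi_eq
  have h0 := phi_nonneg
  rw [cfVal_per31_eq] at h1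
  have h2 : phi * (1 + 1 / (3 + phi)) = 1 := by
    nth_rewrite 1 [h1]
    field_simp
  field_simp at h2
  linarith

theorem cfVal_per31 : cfVal per31 = phi / 3 := by
  have h0 := phi_nonneg
  rw [cfVal_per31_eq]
  field_simp
  linarith [phi_sq]

theorem phi_gt : 0.79128784 < phi := by
  have h0 := phi_nonneg
  nlinarith [phi_sq]

theorem phi_lt : phi < 0.79128785 := by
  have h0 := phi_nonneg
  nlinarith [phi_sq]

theorem cfVal_ge_fifth {θ : ℕ → ℕ} (hθ : θ ∈ Dset) : 1 / 5 ≤ cfVal θ := by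
  have h1 := one_le_of_mem_Dset hθ
  have h2 := cfVal_mem_Icc (a := fun i => θ (i + 1)) fun i => h1 _
  have h3 : θ 0 ≤ 4 := by
    have := hθ.1 0
    simp only [mem_insert_iff, mem_singleton_iff] at this
    omega
  have h3' : (θ 0 : ℝ) ≤ 4 := by exact_mod_cast h3
  have h4 : (1 : ℝ) ≤ θ 0 := by exact_mod_cast h1 0
  rw [cfVal_eq h1]
  exact one_div_le_one_div_of_le (by linarith [h2.1]) (by linarith [h2.2])

theorem one_div_add_le_add {a x y e : ℝ} (ha : 1 ≤ a) (hx : 1 / 5 ≤ x) (hy : 1 / 5 ≤ y)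
    (he : 0 ≤ e) (h : y - e ≤ x) : 1 / (a + x) ≤ 1 / (a + y) + 7 / 10 * e := by
  have h1 : 0 < a + x := by linarith
  have h2 : 0 < a + y := by linarith
  have h3 : 6 / 5 * (6 / 5) ≤ (a + x) * (a + y) := by gcongr <;> linarith
  have : 1 / (a + x) - 1 / (a + y) = (y - x) / ((a + x) * (a + y)) := by
    field_simp; ring
  have h4 : (y - x) / ((a + x) * (a + y)) ≤ 7 / 10 * e := by
    rw [div_le_iff₀ (by positivity)]
    nlinarith
  linarith

theorem shift_mem_Dset {θ : ℕ → ℕ} (hθ : θ ∈ Dset) : (fun i => θ (i + 1)) ∈ Dset :=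
  ⟨fun n => hθ.1 (n + 1), fun n => hθ.2 (n + 1)⟩

theorem cfVal_bounds_approx (k : ℕ) : ∀ θ ∈ Dset, cfVal θ ≤ phi + (7 / 10) ^ k ∧
    1 - phi - (7 / 10) ^ k ≤ cfVal θ ∧ (θ 0 ≠ 4 → phi / 3 - (7 / 10) ^ k ≤ cfVal θ) := by
  have hp := phi_gt
  have hp' := phi_lt
  induction k with
  | zero =>
    intro θ hθ
    have h := cfVal_mem_Icc (one_le_of_mem_Dset hθ)
    refine ⟨?_, ?_, fun _ => ?_⟩ <;> norm_num <;> linarith [h.1, h.2]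
  | succ k ih =>
    intro θ hθ
    obtain ⟨h1, -, h3⟩ := ih _ (shift_mem_Dset hθ)
    have h5 := cfVal_ge_fifth (shift_mem_Dset hθ)
    have hv := cfVal_eq (one_le_of_mem_Dset hθ)
    have hbad := hθ.2 0
    have h0 := hθ.1 0
    set x := cfVal fun i => θ (i + 1)
    set e : ℝ := (7 / 10) ^ k with he
    have he0 : 0 ≤ e := by positivity
    have hp1 : 1 / (1 + phi / 3) = phi := by
      rw [← cfVal_per31, ← phi_eq]
    have hp3 : 1 / (3 + phi) = phi / 3 := by rw [← cfVal_per31, cfVal_per31_eq]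
    have hp4 : 1 / (4 + phi) = 1 - phi := by
      field_simp
      linarith [phi_sq]
    have hx0 : 0 < x := by linarith
    have low : ∀ b : ℝ, 3 ≤ b → 1 / (b + phi) - 7 / 10 * e ≤ 1 / (b + x) := fun b hb => by
      have := one_div_add_le_add (a := b) (x := phi) (y := x) (by linarith) (by linarith) h5 he0
        (by linarith)
      linarith
    have low3 : ∀ b : ℝ, 1 ≤ b → b ≤ 3 → phi / 3 - 7 / 10 * e ≤ 1 / (b + x) := fun b hb hb' => by
      have h : 1 / (3 + x) ≤ 1 / (b + x) := one_div_le_one_div_of_le (by linarith) (by linarith)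
      linarith [low 3 le_rfl]
    have up : ∀ b : ℝ, 2 ≤ b → 1 / (b + x) ≤ phi + 7 / 10 * e := fun b hb => by
      have h : 1 / (b + x) ≤ 1 / 2 := one_div_le_one_div_of_le (by linarith) (by linarith)
      linarith
    rw [hv, pow_succ, ← he]
    simp only [mem_insert_iff, mem_singleton_iff] at h0
    rcases h0 with h | h | h | h <;> rw [h]
    · push_cast
      have h4 := h3 (by rw [h] at hbad; rintro h4; simp [badPairs] at hbad h4; exact hbad h4)
      have := one_div_add_le_add (a := 1) (x := x) (y := phi / 3) le_rfl h5 (by linarith) he0 h4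
      have := low3 1 (by norm_num) (by norm_num)
      refine ⟨by linarith, by linarith, fun _ => by linarith⟩
    · push_cast
      have := low3 2 (by norm_num) (by norm_num)
      refine ⟨by linarith [up 2 le_rfl], by linarith, fun _ => by linarith⟩
    · push_cast
      have := low3 3 (by norm_num) (by norm_num)
      refine ⟨by linarith [up 3 (by norm_num)], by linarith, fun _ => by linarith⟩
    · push_cast
      refine ⟨by linarith [up 4 (by norm_num)], by linarith [low 4 (by norm_num)],
        fun h => absurd rfl h⟩

theorem cfVal_le_phi {θ : ℕ → ℕ} (hθ : θ ∈ Dset) : cfVal θ ≤ phi := by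
  have h : Tendsto (fun k : ℕ => phi + (7 / 10 : ℝ) ^ k) atTop (nhds (phi + 0)) :=
    (tendsto_pow_atTop_nhds_zero_of_lt_one (by norm_num) (by norm_num)).const_add _
  rw [add_zero] at h
  exact ge_of_tendsto' h fun k => (cfVal_bounds_approx k θ hθ).1

theorem phi_div_three_le_cfVal {θ : ℕ → ℕ} (hθ : θ ∈ Dset) (h4 : θ 0 ≠ 4) :
    phi / 3 ≤ cfVal θ := by
  have h : Tendsto (fun k : ℕ => phi / 3 - (7 / 10 : ℝ) ^ k) atTop (nhds (phi / 3 - 0)) :=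
    (tendsto_pow_atTop_nhds_zero_of_lt_one (by norm_num) (by norm_num)).const_sub _
  rw [sub_zero] at h
  exact le_of_tendsto' h fun k => (cfVal_bounds_approx k θ hθ).2.2 h4

/-! ### Compactness -/

theorem isCompact_Dset : IsCompact Dset := by
  have h1 : IsCompact {θ : ℕ → ℕ | ∀ n, θ n ∈ ({1, 2, 3, 4} : Set ℕ)} := by
    have := isCompact_univ_pi (X := fun _ : ℕ => ℕ) (s := fun _ => ({1, 2, 3, 4} : Set ℕ))
      fun _ => (Set.toFinite _).isCompact
    simpa [Set.pi] using this
  have h2 : IsClosed {θ : ℕ → ℕ | ∀ n, (θ n, θ (n + 1)) ∉ badPairs} := by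
    rw [ofPred_forall]
    exact isClosed_iInter fun n => IsClosed.preimage (f := fun θ : ℕ → ℕ => (θ n, θ (n + 1)))
      ((continuous_apply n).prodMk (continuous_apply (n + 1))) (isClosed_discrete badPairsᶜ)
  exact h1.inter_right h2

theorem continuousOn_cfVal : ContinuousOn cfVal Dset := by
  intro θ hθ
  rw [ContinuousWithinAt, Metric.tendsto_nhds]
  intro ε hε
  obtain ⟨k, hk⟩ := exists_nat_one_div_lt hε
  have h : ∀ᶠ η in nhds θ, ∀ i ∈ Finset.range k, η i = θ i :=
    (Filter.eventually_all_finset _).2 fun i _ =>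
      (continuous_apply i).continuousAt.eventually_mem
        ((isOpen_discrete {θ i}).mem_nhds rfl)
  filter_upwards [mem_nhdsWithin_of_mem_nhds h, self_mem_nhdsWithin] with η hη hηD
  rw [Real.dist_eq]
  exact (abs_cfVal_sub_le (one_le_of_mem_Dset hηD) (one_le_of_mem_Dset hθ)
    fun i hi => hη i (Finset.mem_range.2 hi)).trans_lt hk

theorem continuousOn_cfWord {w : List ℕ} (hw : ∀ a ∈ w, 1 ≤ a) :
    ContinuousOn (cfWord w) (Ici 0) := by
  obtain ⟨p, p', u, v, -, -, hu, hv, -, h⟩ := cfWord_mobius hw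
  refine ContinuousOn.congr (f := fun x => (p + p' * x) / (u + v * x)) ?_ fun x hx => h x hx
  refine ContinuousOn.div (by fun_prop) (by fun_prop) fun x hx => ?_
  have : 0 ≤ x := hx
  positivity

theorem Kb_eq_image {w : List ℕ} (hw : ∀ a ∈ w, 1 ≤ a) :
    Kb w = (fun θ => cfWord w (cfVal θ)) ''
      {θ ∈ Dset | ∀ d, w.getLast? = some d → (d, θ 0) ∉ badPairs} := by
  ext x
  constructor
  · rintro ⟨θ, hθ, h, rfl⟩
    exact ⟨θ, ⟨hθ, h⟩, (cfVal_app hw (one_le_of_mem_Dset hθ)).symm⟩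
  · rintro ⟨θ, ⟨hθ, h⟩, rfl⟩
    exact ⟨θ, hθ, h, (cfVal_app hw (one_le_of_mem_Dset hθ)).symm⟩

theorem isCompact_Kb {w : List ℕ} (hw : ∀ a ∈ w, 1 ≤ a) : IsCompact (Kb w) := by
  rw [Kb_eq_image hw]
  refine IsCompact.image_of_continuousOn (isCompact_Dset.inter_right ?_) ?_
  · exact IsClosed.preimage (f := fun θ : ℕ → ℕ => θ 0) (continuous_apply 0)
      (isClosed_discrete {j | ∀ d, w.getLast? = some d → (d, j) ∉ badPairs})
  · refine (continuousOn_cfWord hw).comp (continuousOn_cfVal.mono fun θ h => h.1) ?_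
    exact fun θ h => (cfVal_mem_Icc (one_le_of_mem_Dset h.1)).1

/-! ### Sums of Cantor sets with thick bridges -/

/-- A family of bridges of `K`: a quadruple `(a, c, d, b)` stands for the interval with endpoints
`a, b` (in either order) from which the gap between `c` and `d` is removed. The gap is no longer
than the two remaining pieces, which are again bridges, with shorter gaps. -/
def IsBridgeSystem (K : Set ℝ) (U : Set (ℝ × ℝ × ℝ × ℝ)) : Prop :=
  ∀ a c d b, (a, c, d, b) ∈ U → a ∈ K ∧ (a ≤ c ∧ c ≤ d ∧ d ≤ b ∨ b ≤ d ∧ d ≤ c ∧ c ≤ a) ∧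
    |d - c| ≤ |c - a| ∧ |d - c| ≤ |b - d| ∧ |b - a| ≤ 10 * |d - c| ∧
    (∃ e f, ((a, e, f, c) ∈ U ∨ (c, e, f, a) ∈ U) ∧ |f - e| ≤ |d - c|) ∧
    (∃ e f, ((d, e, f, b) ∈ U ∨ (b, e, f, d) ∈ U) ∧ |f - e| ≤ |d - c|)

theorem exists_bridge_of_gap_le {K : Set ℝ} {U : Set (ℝ × ℝ × ℝ × ℝ)} (hU : IsBridgeSystem K U)
    {a c d b a' b' t : ℝ} (hq : (a, c, d, b) ∈ U) (hgap : |d - c| ≤ |b' - a'|)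
    (ht : ∃ x ∈ uIcc a b, t - x ∈ uIcc a' b') :
    ∃ a₁ c₁ d₁ b₁, (a₁, c₁, d₁, b₁) ∈ U ∧ |d₁ - c₁| ≤ |d - c| ∧ |d - c| ≤ |b₁ - a₁| ∧
      |b₁ - a₁| ≤ |b - a| - |d - c| ∧ ∃ x ∈ uIcc a₁ b₁, t - x ∈ uIcc a' b' := by
  obtain ⟨-, hord, h1, h2, h3, ⟨e, f, hl, hl'⟩, e', f', hr, hr'⟩ := hU a c d b hq
  have key : (∃ x ∈ uIcc a c, t - x ∈ uIcc a' b') ∨ (∃ x ∈ uIcc d b, t - x ∈ uIcc a' b') := by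
    obtain ⟨x, hx, htx⟩ := ht
    simp only [mem_uIcc] at *
    have hx' : (x ∈ Icc a c ∨ x ∈ Icc c a) ∨ (x ∈ Icc d b ∨ x ∈ Icc b d) ∨
        (x ∈ Icc c d ∨ x ∈ Icc d c) := by
      simp only [mem_Icc]
      rcases hx with hx | hx <;> rcases hord with ho | ho <;> rcases le_total x c with h | h <;>
        rcases le_total x d with h' | h' <;> grind
    rcases hx' with h | h | h
    · exact Or.inl ⟨x, h, htx⟩
    · exact Or.inr ⟨x, h, htx⟩
    · have hcd : |d - c| ≤ b' - a' ∨ |d - c| ≤ a' - b' := by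
        rcases le_total 0 (b' - a') with h | h
        · left; rwa [abs_of_nonneg h] at hgap
        · right; rw [abs_of_nonpos h] at hgap; linarith
      have hd1 := le_abs_self (d - c)
      have hd2 := neg_abs_le (d - c)
      by_cases hc : a' ≤ t - c ∧ t - c ≤ b' ∨ b' ≤ t - c ∧ t - c ≤ a'
      · refine Or.inl ⟨c, ?_, hc⟩
        grind
      · refine Or.inr ⟨d, ?_, ?_⟩
        · grind
        · simp only [mem_Icc] at h
          grind
  have hlen : |c - a| + |d - c| + |b - d| = |b - a| := by
    rcases hord with ⟨o1, o2, o3⟩ | ⟨o1, o2, o3⟩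
    · rw [abs_of_nonneg (by linarith), abs_of_nonneg (by linarith), abs_of_nonneg (by linarith),
        abs_of_nonneg (by linarith)]
      ring
    · rw [abs_of_nonpos (by linarith), abs_of_nonpos (by linarith), abs_of_nonpos (by linarith),
        abs_of_nonpos (by linarith)]
      ring
  have hn := abs_nonneg (c - a)
  have hn' := abs_nonneg (b - d)
  rcases key with h | h
  · rcases hl with hl | hl
    · exact ⟨a, e, f, c, hl, hl', h1, by linarith, h⟩
    · refine ⟨c, e, f, a, hl, hl', ?_, ?_, by rwa [uIcc_comm]⟩ <;> rw [abs_sub_comm a c] <;>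
        linarith
  · rcases hr with hr | hr
    · exact ⟨d, e', f', b, hr, hr', h2, by linarith, h⟩
    · refine ⟨b, e', f', d, hr, hr', ?_, ?_, by rwa [uIcc_comm]⟩ <;> rw [abs_sub_comm d b] <;>
        linarith

theorem exists_small_bridges {K K' : Set ℝ} {U U' : Set (ℝ × ℝ × ℝ × ℝ)}
    (hU : IsBridgeSystem K U) (hU' : IsBridgeSystem K' U') {a c d b a' c' d' b' t : ℝ}
    (hq : (a, c, d, b) ∈ U) (hq' : (a', c', d', b') ∈ U') (hgap : |d - c| ≤ |b' - a'|)
    (hgap' : |d' - c'| ≤ |b - a|) (ht : ∃ x ∈ uIcc a b, t - x ∈ uIcc a' b') (n : ℕ) :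
    ∃ a₁ c₁ d₁ b₁ a₂ c₂ d₂ b₂, (a₁, c₁, d₁, b₁) ∈ U ∧ (a₂, c₂, d₂, b₂) ∈ U' ∧
      |d₁ - c₁| ≤ |b₂ - a₂| ∧ |d₂ - c₂| ≤ |b₁ - a₁| ∧
      |b₁ - a₁| + |b₂ - a₂| ≤ (19 / 20) ^ n * (|b - a| + |b' - a'|) ∧
      ∃ x ∈ uIcc a₁ b₁, t - x ∈ uIcc a₂ b₂ := by
  induction n with
  | zero => exact ⟨a, c, d, b, a', c', d', b', hq, hq', hgap, hgap', by simp, ht⟩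
  | succ n ih =>
    obtain ⟨a₁, c₁, d₁, b₁, a₂, c₂, d₂, b₂, h₁, h₂, g₁, g₂, hs, hx⟩ := ih
    obtain ⟨-, -, -, -, k₁, -⟩ := hU _ _ _ _ h₁
    obtain ⟨-, -, -, -, k₂, -⟩ := hU' _ _ _ _ h₂
    rw [pow_succ]
    rcases le_total |d₂ - c₂| |d₁ - c₁| with h | h
    · obtain ⟨a₃, c₃, d₃, b₃, h₃, s₁, s₂, s₃, hx₃⟩ := exists_bridge_of_gap_le hU h₁ g₁ hx
      refine ⟨a₃, c₃, d₃, b₃, a₂, c₂, d₂, b₂, h₃, h₂, s₁.trans g₁, h.trans s₂, ?_, hx₃⟩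
      linarith
    · have hx' : ∃ x ∈ uIcc a₂ b₂, t - x ∈ uIcc a₁ b₁ := by
        obtain ⟨x, hx1, hx2⟩ := hx
        exact ⟨t - x, hx2, by simpa using hx1⟩
      obtain ⟨a₃, c₃, d₃, b₃, h₃, s₁, s₂, s₃, y, hy, hy'⟩ := exists_bridge_of_gap_le hU' h₂ g₂ hx'
      refine ⟨a₁, c₁, d₁, b₁, a₃, c₃, d₃, b₃, h₁, h₃, h.trans s₂, s₁.trans g₂, ?_, t - y, hy',
        by simpa using hy⟩
      linarith

theorem Icc_subset_add {K K' : Set ℝ} (hK : IsCompact K) (hK' : IsCompact K')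
    {U U' : Set (ℝ × ℝ × ℝ × ℝ)} (hU : IsBridgeSystem K U) (hU' : IsBridgeSystem K' U')
    {a c d b a' c' d' b' : ℝ} (hq : (a, c, d, b) ∈ U) (hq' : (a', c', d', b') ∈ U')
    (hgap : |d - c| ≤ |b' - a'|) (hgap' : |d' - c'| ≤ |b - a|) {t : ℝ}
    (ht : ∃ x ∈ uIcc a b, t - x ∈ uIcc a' b') : t ∈ K + K' := by
  rw [← (hK.add hK').isClosed.closure_eq, Metric.mem_closure_iff]
  intro ε hε
  have hlim : Tendsto (fun n : ℕ => (19 / 20 : ℝ) ^ n * (|b - a| + |b' - a'|)) atTop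
      (nhds (0 * (|b - a| + |b' - a'|))) :=
    (tendsto_pow_atTop_nhds_zero_of_lt_one (by norm_num) (by norm_num)).mul_const _
  rw [zero_mul] at hlim
  obtain ⟨n, hn⟩ := (hlim.eventually_lt_const hε).exists
  obtain ⟨a₁, c₁, d₁, b₁, a₂, c₂, d₂, b₂, h₁, h₂, -, -, hs, x, hx, hx'⟩ :=
    exists_small_bridges hU hU' hq hq' hgap hgap' ht n
  refine ⟨a₁ + a₂, add_mem_add (hU _ _ _ _ h₁).1 (hU' _ _ _ _ h₂).1, ?_⟩
  have e1 := abs_sub_left_of_mem_uIcc hx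
  have e2 := abs_sub_left_of_mem_uIcc hx'
  rw [Real.dist_eq]
  calc |t - (a₁ + a₂)| = |(x - a₁) + (t - x - a₂)| := by ring_nf
    _ ≤ |x - a₁| + |t - x - a₂| := abs_add_le _ _
    _ < ε := by linarith

/-! ### The bridges of the sets `Kb w` -/

/-- `Block S y₀ y₁ y₂ y₃` says that `[y₀, y₃]` is the convex hull of the values of the tails
starting with a letter of `S`, and `(y₁, y₂)` the gap removed from it. -/
inductive Block : Set ℕ → ℝ → ℝ → ℝ → ℝ → Prop
  | b123 : Block {1, 2, 3} (phi / 3) ((3 - phi) / 5) ((phi + 2) / 5) phi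
  | b23 : Block {2, 3} (phi / 3) ((7 + phi) / 25) ((phi + 1) / 5) ((3 - phi) / 5)
  | b1234 : Block {1, 2, 3, 4} (1 - phi) ((3 - phi) / 5) ((phi + 2) / 5) phi
  | b234 : Block {2, 3, 4} (1 - phi) ((7 + phi) / 25) ((phi + 1) / 5) ((3 - phi) / 5)
  | b34 : Block {3, 4} (1 - phi) ((8 + phi) / 37) (phi / 3) ((7 + phi) / 25)

/-- The interval `[x, y]` of tails, left over from a block with letters in `S` and gap `[c, d]`,
is again a block, possibly after removal of the first letter. -/
def SubBlock (S : Set ℕ) (x y c d : ℝ) : Prop :=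
  (∃ S' ⊆ S, ∃ e f, Block S' x e f y ∧
    ∀ w : List ℕ, (∀ a ∈ w, 1 ≤ a) → |cfWord w f - cfWord w e| ≤ |cfWord w d - cfWord w c|) ∨
  ∃ j ∈ S, 1 ≤ j ∧ ∃ S', (∀ θ ∈ Dset, θ 0 ∈ S' → app [j] θ ∈ Dset) ∧ ∃ z₀ e f z₃,
    Block S' z₀ e f z₃ ∧ x = 1 / (j + z₃) ∧ y = 1 / (j + z₀) ∧
    ∀ w : List ℕ, (∀ a ∈ w, 1 ≤ a) →
      |cfWord w (1 / (j + e)) - cfWord w (1 / (j + f))| ≤ |cfWord w d - cfWord w c|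

theorem Block.ordered {S : Set ℕ} {y₀ y₁ y₂ y₃ : ℝ} (h : Block S y₀ y₁ y₂ y₃) :
    0 ≤ y₀ ∧ y₀ ≤ y₁ ∧ y₁ ≤ y₂ ∧ y₂ ≤ y₃ := by
  have h1 := phi_gt
  have h2 := phi_lt
  cases h <;> refine ⟨?_, ?_, ?_, ?_⟩ <;> linarith

theorem app_singleton_mem_of_lt_four {j : ℕ} (hj : j ∈ ({1, 2, 3, 4} : Set ℕ)) {θ : ℕ → ℕ}
    (hθ : θ ∈ Dset) (h : θ 0 ∈ ({1, 2, 3} : Set ℕ)) : app [j] θ ∈ Dset := by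
  refine app_singleton_mem_Dset hθ hj ?_
  simp only [badPairs, mem_insert_iff, mem_singleton_iff, Prod.mk.injEq] at h ⊢
  omega

theorem app_singleton_mem_of_two_lt {j : ℕ} (hj : j ∈ ({3, 4} : Set ℕ)) {θ : ℕ → ℕ}
    (hθ : θ ∈ Dset) : app [j] θ ∈ Dset := by
  simp only [mem_insert_iff, mem_singleton_iff] at hj
  refine app_singleton_mem_Dset hθ ?_ ?_ <;>
  simp only [badPairs, mem_insert_iff, mem_singleton_iff, Prod.mk.injEq] <;>
  omega

theorem cfVal_app_singleton {j : ℕ} (hj : 1 ≤ j) {θ : ℕ → ℕ} (hθ : θ ∈ Dset) :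
    cfVal (app [j] θ) = 1 / (j + cfVal θ) := by
  rw [cfVal_app (by simpa using hj) (one_le_of_mem_Dset hθ), cfWord_cons, cfWord_nil]

theorem one_div_four_add_phi : 1 / (4 + phi) = 1 - phi := by
  have := phi_nonneg
  field_simp
  linarith [phi_sq]

theorem Block.exists_tail {S : Set ℕ} {y₀ y₁ y₂ y₃ : ℝ} (h : Block S y₀ y₁ y₂ y₃) :
    ∃ θ ∈ Dset, θ 0 ∈ S ∧ cfVal θ = y₀ := by
  have h4 : app [4] per13 ∈ Dset := app_singleton_mem_of_two_lt (by simp) per13_mem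
  have h4' : cfVal (app [4] per13) = 1 - phi := by
    rw [cfVal_app_singleton (by norm_num) per13_mem, ← one_div_four_add_phi]
    norm_num [phi]
  cases h
  · exact ⟨per31, per31_mem, by simp [per31], cfVal_per31⟩
  · exact ⟨per31, per31_mem, by simp [per31], cfVal_per31⟩
  · exact ⟨_, h4, by simp [app], h4'⟩
  · exact ⟨_, h4, by simp [app], h4'⟩
  · exact ⟨_, h4, by simp [app], h4'⟩

theorem near_phi : Near phi 0.7912878 := by
  constructor <;> linarith [phi_gt, phi_lt]

theorem near_phi_div_three : Near (phi / 3) 0.2637626 := by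
  constructor <;> linarith [phi_gt, phi_lt]

theorem near_one_sub_phi : Near (1 - phi) 0.2087122 := by
  constructor <;> linarith [phi_gt, phi_lt]

theorem near_max_two : Near ((3 - phi) / 5) 0.4417424 := by
  constructor <;> linarith [phi_gt, phi_lt]

theorem near_min_one : Near ((phi + 2) / 5) 0.5582576 := by
  constructor <;> linarith [phi_gt, phi_lt]

theorem near_min_two : Near ((phi + 1) / 5) 0.3582576 := by
  constructor <;> linarith [phi_gt, phi_lt]

theorem near_max_three : Near ((7 + phi) / 25) 0.3116515 := by
  constructor <;> linarith [phi_gt, phi_lt]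

theorem near_max_four : Near ((8 + phi) / 37) 0.2376024 := by
  constructor <;> linarith [phi_gt, phi_lt]

theorem near_one_div_add {x x₀ : ℝ} (hx : Near x x₀) {j y₀ : ℝ} (hx₀ : 1 / 10 ^ 6 ≤ x₀) (hj : 1 ≤ j)
    (h : 1 ≤ (y₀ + 1 / 10 ^ 6) * (j + x₀ - 1 / 10 ^ 6) ∧
      (y₀ - 1 / 10 ^ 6) * (j + x₀ + 1 / 10 ^ 6) ≤ 1) (hy₀ : 1 / 10 ^ 6 ≤ y₀) :
    Near (1 / (j + x)) y₀ := by
  obtain ⟨h1, h2⟩ := h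
  obtain ⟨h3, h4⟩ := hx
  constructor
  · rw [le_div_iff₀ (by linarith)]
    nlinarith
  · rw [div_le_iff₀ (by linarith)]
    nlinarith

theorem subBlock_of_le_two {S : Set ℕ} {j : ℕ} (hj : j ∈ S) (hj' : j ∈ ({1, 2} : Set ℕ))
    {x y c d : ℝ} (hx : x = 1 / (j + phi)) (hy : y = 1 / (j + phi / 3))
    (hgap : ∀ w : List ℕ, (∀ a ∈ w, 1 ≤ a) →
      |cfWord w (1 / (j + (3 - phi) / 5)) - cfWord w (1 / (j + (phi + 2) / 5))| ≤
        1 * |cfWord w d - cfWord w c|) :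
    SubBlock S x y c d := by
  have hj4 : 1 ≤ j ∧ j ∈ ({1, 2, 3, 4} : Set ℕ) := by
    simp only [mem_insert_iff, mem_singleton_iff] at hj' ⊢
    omega
  refine Or.inr ⟨j, hj, hj4.1, _, fun θ hθ h => app_singleton_mem_of_lt_four hj4.2 hθ h,
    _, _, _, _, .b123, hx, hy, fun w hw => (hgap w hw).trans_eq (one_mul _)⟩

theorem subBlock_of_three_le {S : Set ℕ} {j : ℕ} (hj : j ∈ S) (hj' : j ∈ ({3, 4} : Set ℕ))
    {x y c d : ℝ} (hx : x = 1 / (j + phi)) (hy : y = 1 / (j + (1 - phi)))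
    (hgap : ∀ w : List ℕ, (∀ a ∈ w, 1 ≤ a) →
      |cfWord w (1 / (j + (3 - phi) / 5)) - cfWord w (1 / (j + (phi + 2) / 5))| ≤
        1 * |cfWord w d - cfWord w c|) :
    SubBlock S x y c d := by
  have hj1 : 1 ≤ j := by
    simp only [mem_insert_iff, mem_singleton_iff] at hj'
    omega
  refine Or.inr ⟨j, hj, hj1, _, fun θ hθ _ => app_singleton_mem_of_two_lt hj' hθ,
    _, _, _, _, .b1234, hx, hy, fun w hw => (hgap w hw).trans_eq (one_mul _)⟩

theorem subBlock_of_subset {S S' : Set ℕ} (hS : S' ⊆ S) {x e f y c d : ℝ} (h : Block S' x e f y)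
    (hgap : ∀ w : List ℕ, (∀ a ∈ w, 1 ≤ a) →
      |cfWord w f - cfWord w e| ≤ 1 * |cfWord w d - cfWord w c|) :
    SubBlock S x y c d :=
  Or.inl ⟨S', hS, e, f, h, fun w hw => (hgap w hw).trans_eq (one_mul _)⟩

theorem near_one_max_two : Near (1 / (((1 : ℕ) : ℝ) + (3 - phi) / 5)) 0.6936052 :=
  near_one_div_add near_max_two (by norm_num) (by norm_num) (by norm_num) (by norm_num)

theorem near_one_min_one : Near (1 / (((1 : ℕ) : ℝ) + (phi + 2) / 5)) 0.6417424 :=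
  near_one_div_add near_min_one (by norm_num) (by norm_num) (by norm_num) (by norm_num)

theorem near_two_max_two : Near (1 / (((2 : ℕ) : ℝ) + (3 - phi) / 5)) 0.4095436 :=
  near_one_div_add near_max_two (by norm_num) (by norm_num) (by norm_num) (by norm_num)

theorem near_two_min_one : Near (1 / (((2 : ℕ) : ℝ) + (phi + 2) / 5)) 0.3908911 :=
  near_one_div_add near_min_one (by norm_num) (by norm_num) (by norm_num) (by norm_num)

theorem near_three_max_two : Near (1 / (((3 : ℕ) : ℝ) + (3 - phi) / 5)) 0.2905505 :=
  near_one_div_add near_max_two (by norm_num) (by norm_num) (by norm_num) (by norm_num)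

theorem near_three_min_one : Near (1 / (((3 : ℕ) : ℝ) + (phi + 2) / 5)) 0.2810364 :=
  near_one_div_add near_min_one (by norm_num) (by norm_num) (by norm_num) (by norm_num)

theorem near_four_max_two : Near (1 / (((4 : ℕ) : ℝ) + (3 - phi) / 5)) 0.2251369 :=
  near_one_div_add near_max_two (by norm_num) (by norm_num) (by norm_num) (by norm_num)

theorem near_four_min_one : Near (1 / (((4 : ℕ) : ℝ) + (phi + 2) / 5)) 0.2193821 :=
  near_one_div_add near_min_one (by norm_num) (by norm_num) (by norm_num) (by norm_num)

theorem gap_letter_one_le_gap_12 {w : List ℕ} (hw : ∀ a ∈ w, 1 ≤ a) :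
    |cfWord w (1 / (((1 : ℕ) : ℝ) + (3 - phi) / 5)) -
        cfWord w (1 / (((1 : ℕ) : ℝ) + (phi + 2) / 5))| ≤
      1 * |cfWord w ((phi + 2) / 5) - cfWord w ((3 - phi) / 5)| :=
  abs_cfWord_sub_le_of_near hw _ _ _ _ _ near_max_two near_min_one near_one_min_one
    near_one_max_two (by norm_num) (by norm_num)

theorem gap_letter_two_le_gap_23 {w : List ℕ} (hw : ∀ a ∈ w, 1 ≤ a) :
    |cfWord w (1 / (((2 : ℕ) : ℝ) + (3 - phi) / 5)) -
        cfWord w (1 / (((2 : ℕ) : ℝ) + (phi + 2) / 5))| ≤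
      1 * |cfWord w ((phi + 1) / 5) - cfWord w ((7 + phi) / 25)| :=
  abs_cfWord_sub_le_of_near hw _ _ _ _ _ near_max_three near_min_two near_two_min_one
    near_two_max_two (by norm_num) (by norm_num)

theorem gap_letter_three_le_gap_23 {w : List ℕ} (hw : ∀ a ∈ w, 1 ≤ a) :
    |cfWord w (1 / (((3 : ℕ) : ℝ) + (3 - phi) / 5)) -
        cfWord w (1 / (((3 : ℕ) : ℝ) + (phi + 2) / 5))| ≤
      1 * |cfWord w ((phi + 1) / 5) - cfWord w ((7 + phi) / 25)| :=
  abs_cfWord_sub_le_of_near hw _ _ _ _ _ near_max_three near_min_two near_three_min_one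
    near_three_max_two (by norm_num) (by norm_num)

theorem gap_letter_three_le_gap_34 {w : List ℕ} (hw : ∀ a ∈ w, 1 ≤ a) :
    |cfWord w (1 / (((3 : ℕ) : ℝ) + (3 - phi) / 5)) -
        cfWord w (1 / (((3 : ℕ) : ℝ) + (phi + 2) / 5))| ≤
      1 * |cfWord w (phi / 3) - cfWord w ((8 + phi) / 37)| :=
  abs_cfWord_sub_le_of_near hw _ _ _ _ _ near_max_four near_phi_div_three near_three_min_one
    near_three_max_two (by norm_num) (by norm_num)

theorem gap_letter_four_le_gap_34 {w : List ℕ} (hw : ∀ a ∈ w, 1 ≤ a) :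
    |cfWord w (1 / (((4 : ℕ) : ℝ) + (3 - phi) / 5)) -
        cfWord w (1 / (((4 : ℕ) : ℝ) + (phi + 2) / 5))| ≤
      1 * |cfWord w (phi / 3) - cfWord w ((8 + phi) / 37)| :=
  abs_cfWord_sub_le_of_near hw _ _ _ _ _ near_max_four near_phi_div_three near_four_min_one
    near_four_max_two (by norm_num) (by norm_num)

theorem gap_23_le_gap_12 {w : List ℕ} (hw : ∀ a ∈ w, 1 ≤ a) :
    |cfWord w ((phi + 1) / 5) - cfWord w ((7 + phi) / 25)| ≤
      1 * |cfWord w ((phi + 2) / 5) - cfWord w ((3 - phi) / 5)| :=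
  abs_cfWord_sub_le_of_near hw _ _ _ _ _ near_max_two near_min_one near_max_three
    near_min_two (by norm_num) (by norm_num)

theorem gap_34_le_gap_23 {w : List ℕ} (hw : ∀ a ∈ w, 1 ≤ a) :
    |cfWord w (phi / 3) - cfWord w ((8 + phi) / 37)| ≤
      1 * |cfWord w ((phi + 1) / 5) - cfWord w ((7 + phi) / 25)| := by
  have h1 := phi_gt
  have h2 := phi_lt
  have hsq := phi_sq
  have hcube : phi ^ 3 = 3 * phi - 3 * phi ^ 2 := by
    rw [pow_succ, hsq]; linarith
  refine abs_cfWord_sub_le hw ?_ ?_ ?_ ?_ ?_ ?_ ?_ <;> linarith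

theorem min_letter_one : (phi + 2) / 5 = 1 / (((1 : ℕ) : ℝ) + phi) := by
  rw [eq_div_iff (by push_cast; linarith [phi_gt, phi_lt])]
  push_cast
  linarith [phi_sq]

theorem max_letter_one : phi = 1 / (((1 : ℕ) : ℝ) + phi / 3) := by
  rw [eq_div_iff (by push_cast; linarith [phi_gt, phi_lt])]
  push_cast
  linarith [phi_sq]

theorem min_letter_two : (phi + 1) / 5 = 1 / (((2 : ℕ) : ℝ) + phi) := by
  rw [eq_div_iff (by push_cast; linarith [phi_gt, phi_lt])]
  push_cast
  linarith [phi_sq]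

theorem max_letter_two : (3 - phi) / 5 = 1 / (((2 : ℕ) : ℝ) + phi / 3) := by
  rw [eq_div_iff (by push_cast; linarith [phi_gt, phi_lt])]
  push_cast
  linarith [phi_sq]

theorem min_letter_three : phi / 3 = 1 / (((3 : ℕ) : ℝ) + phi) := by
  rw [eq_div_iff (by push_cast; linarith [phi_gt, phi_lt])]
  push_cast
  linarith [phi_sq]

theorem max_letter_three : (7 + phi) / 25 = 1 / (((3 : ℕ) : ℝ) + (1 - phi)) := by
  rw [eq_div_iff (by push_cast; linarith [phi_gt, phi_lt])]
  push_cast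
  linarith [phi_sq]

theorem min_letter_four : 1 - phi = 1 / (((4 : ℕ) : ℝ) + phi) := by
  rw [eq_div_iff (by push_cast; linarith [phi_gt, phi_lt])]
  push_cast
  linarith [phi_sq]

theorem max_letter_four : (8 + phi) / 37 = 1 / (((4 : ℕ) : ℝ) + (1 - phi)) := by
  rw [eq_div_iff (by push_cast; linarith [phi_gt, phi_lt])]
  push_cast
  linarith [phi_sq]

theorem Block.subBlock {S : Set ℕ} {y₀ y₁ y₂ y₃ : ℝ} (h : Block S y₀ y₁ y₂ y₃) :
    SubBlock S y₀ y₁ y₁ y₂ ∧ SubBlock S y₂ y₃ y₁ y₂ := by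
  cases h
  · exact ⟨subBlock_of_subset (by grind) .b23 fun _ => gap_23_le_gap_12,
      subBlock_of_le_two (j := 1) (by simp) (by simp) min_letter_one max_letter_one
        fun _ => gap_letter_one_le_gap_12⟩
  · exact ⟨subBlock_of_three_le (j := 3) (by simp) (by simp) min_letter_three max_letter_three
        fun _ => gap_letter_three_le_gap_23,
      subBlock_of_le_two (j := 2) (by simp) (by simp) min_letter_two max_letter_two
        fun _ => gap_letter_two_le_gap_23⟩
  · exact ⟨subBlock_of_subset (by grind) .b234 fun _ => gap_23_le_gap_12,
      subBlock_of_le_two (j := 1) (by simp) (by simp) min_letter_one max_letter_one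
        fun _ => gap_letter_one_le_gap_12⟩
  · exact ⟨subBlock_of_subset (by grind) .b34 fun _ => gap_34_le_gap_23,
      subBlock_of_le_two (j := 2) (by simp) (by simp) min_letter_two max_letter_two
        fun _ => gap_letter_two_le_gap_23⟩
  · exact ⟨subBlock_of_three_le (j := 4) (by simp) (by simp) min_letter_four max_letter_four
        fun _ => gap_letter_four_le_gap_34,
      subBlock_of_three_le (j := 3) (by simp) (by simp) min_letter_three max_letter_three
        fun _ => gap_letter_three_le_gap_34⟩

theorem Block.thick {S : Set ℕ} {y₀ y₁ y₂ y₃ : ℝ} (h : Block S y₀ y₁ y₂ y₃) {w : List ℕ}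
    (hw : ∀ a ∈ w, 1 ≤ a) : |cfWord w y₂ - cfWord w y₁| ≤ 1 * |cfWord w y₁ - cfWord w y₀| ∧
      |cfWord w y₂ - cfWord w y₁| ≤ 1 * |cfWord w y₃ - cfWord w y₂| ∧
      |cfWord w y₃ - cfWord w y₀| ≤ 10 * |cfWord w y₂ - cfWord w y₁| := by
  cases h
  · refine ⟨?_, ?_, ?_⟩
    · exact abs_cfWord_sub_le_of_near hw _ _ _ _ _ near_phi_div_three near_max_two near_max_two
        near_min_one (by norm_num) (by norm_num)
    · exact abs_cfWord_sub_le_of_near hw _ _ _ _ _ near_min_one near_phi near_max_two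
        near_min_one (by norm_num) (by norm_num)
    · exact abs_cfWord_sub_le_of_near hw _ _ _ _ _ near_max_two near_min_one near_phi_div_three
        near_phi (by norm_num) (by norm_num)
  · refine ⟨?_, ?_, ?_⟩
    · exact abs_cfWord_sub_le_of_near hw _ _ _ _ _ near_phi_div_three near_max_three near_max_three
        near_min_two (by norm_num) (by norm_num)
    · exact abs_cfWord_sub_le_of_near hw _ _ _ _ _ near_min_two near_max_two near_max_three
        near_min_two (by norm_num) (by norm_num)
    · exact abs_cfWord_sub_le_of_near hw _ _ _ _ _ near_max_three near_min_two near_phi_div_three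
        near_max_two (by norm_num) (by norm_num)
  · refine ⟨?_, ?_, ?_⟩
    · exact abs_cfWord_sub_le_of_near hw _ _ _ _ _ near_one_sub_phi near_max_two near_max_two
        near_min_one (by norm_num) (by norm_num)
    · exact abs_cfWord_sub_le_of_near hw _ _ _ _ _ near_min_one near_phi near_max_two
        near_min_one (by norm_num) (by norm_num)
    · exact abs_cfWord_sub_le_of_near hw _ _ _ _ _ near_max_two near_min_one near_one_sub_phi
        near_phi (by norm_num) (by norm_num)
  · refine ⟨?_, ?_, ?_⟩
    · exact abs_cfWord_sub_le_of_near hw _ _ _ _ _ near_one_sub_phi near_max_three near_max_three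
        near_min_two (by norm_num) (by norm_num)
    · exact abs_cfWord_sub_le_of_near hw _ _ _ _ _ near_min_two near_max_two near_max_three
        near_min_two (by norm_num) (by norm_num)
    · exact abs_cfWord_sub_le_of_near hw _ _ _ _ _ near_max_three near_min_two near_one_sub_phi
        near_max_two (by norm_num) (by norm_num)
  · refine ⟨?_, ?_, ?_⟩
    · exact abs_cfWord_sub_le_of_near hw _ _ _ _ _ near_one_sub_phi near_max_four near_max_four
        near_phi_div_three (by norm_num) (by norm_num)
    · exact abs_cfWord_sub_le_of_near hw _ _ _ _ _ near_phi_div_three near_max_three near_max_four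
        near_phi_div_three (by norm_num) (by norm_num)
    · exact abs_cfWord_sub_le_of_near hw _ _ _ _ _ near_max_four near_phi_div_three near_one_sub_phi
        near_max_three (by norm_num) (by norm_num)

/-- The bridges of `K` obtained from the finite words all of whose admissible continuations
have their value in `K`. -/
def bridges (K : Set ℝ) : Set (ℝ × ℝ × ℝ × ℝ) :=
  {q | ∃ w : List ℕ, (∀ a ∈ w, 1 ≤ a) ∧ ∃ S y₀ y₁ y₂ y₃, Block S y₀ y₁ y₂ y₃ ∧
    (∀ θ ∈ Dset, θ 0 ∈ S → cfVal (app w θ) ∈ K) ∧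
    q = (cfWord w y₀, cfWord w y₁, cfWord w y₂, cfWord w y₃)}

theorem exists_bridge_of_subBlock {K : Set ℝ} {w : List ℕ} (hw : ∀ a ∈ w, 1 ≤ a) {S : Set ℕ}
    (hK : ∀ θ ∈ Dset, θ 0 ∈ S → cfVal (app w θ) ∈ K) {x y c d : ℝ} (h : SubBlock S x y c d) :
    ∃ e f, ((cfWord w x, e, f, cfWord w y) ∈ bridges K ∨
      (cfWord w y, e, f, cfWord w x) ∈ bridges K) ∧ |f - e| ≤ |cfWord w d - cfWord w c| := by
  rcases h with ⟨S', hS, e, f, hb, hgap⟩ | ⟨j, hj, hj1, S', hS', z₀, e, f, z₃, hb, rfl, rfl, hgap⟩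
  · exact ⟨_, _, Or.inl ⟨w, hw, S', _, _, _, _, hb, fun θ hθ h => hK θ hθ (hS h), rfl⟩, hgap w hw⟩
  · refine ⟨cfWord w (1 / (j + e)), cfWord w (1 / (j + f)),
      Or.inr ⟨w ++ [j], ?_, S', _, _, _, _, hb, fun θ hθ h => ?_, ?_⟩, ?_⟩
    · intro a ha
      rcases List.mem_append.1 ha with h | h
      · exact hw a h
      · rwa [List.mem_singleton.1 h]
    · rw [app_append]
      exact hK _ (hS' θ hθ h) (by rwa [app_cons_zero])
    · simp only [cfWord_append, cfWord_cons, cfWord_nil]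
    · rw [abs_sub_comm]
      exact hgap w hw

theorem isBridgeSystem_bridges (K : Set ℝ) : IsBridgeSystem K (bridges K) := by
  rintro a c d b ⟨w, hw, S, y₀, y₁, y₂, y₃, hb, hK, hq⟩
  obtain ⟨rfl, rfl, rfl, rfl⟩ : a = _ ∧ c = _ ∧ d = _ ∧ b = _ := by simpa using hq
  obtain ⟨o1, o2, o3, o4⟩ := hb.ordered
  obtain ⟨t1, t2, t3⟩ := hb.thick hw
  rw [one_mul] at t1 t2
  refine ⟨?_, ?_, t1, t2, t3, exists_bridge_of_subBlock hw hK hb.subBlock.1,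
    exists_bridge_of_subBlock hw hK hb.subBlock.2⟩
  · obtain ⟨θ, hθ, h, rfl⟩ := hb.exists_tail
    rw [← cfVal_app hw (one_le_of_mem_Dset hθ)]
    exact hK θ hθ h
  · rcases Nat.even_or_odd w.length with h | h
    · exact Or.inl ⟨cfWord_mono hw h o1 o2, cfWord_mono hw h (o1.trans o2) o3,
        cfWord_mono hw h (o1.trans (o2.trans o3)) o4⟩
    · exact Or.inr ⟨cfWord_anti hw h (o1.trans (o2.trans o3)) o4,
        cfWord_anti hw h (o1.trans o2) o3, cfWord_anti hw h o1 o2⟩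

/-! ### Extremal points of the sets `Kb w` -/

theorem notMem_badPairs_iff {d j : ℕ} (hd : d = 1 ∨ d = 2) : (d, j) ∉ badPairs ↔ j ≠ 4 := by
  simp only [badPairs, mem_insert_iff, mem_singleton_iff, Prod.mk.injEq]
  omega

theorem mem_Kb_append {w : List ℕ} {d : ℕ} (hd : d = 1 ∨ d = 2) {x : ℝ} :
    x ∈ Kb (w ++ [d]) ↔ ∃ θ ∈ Dset, θ 0 ≠ 4 ∧ x = cfVal (app (w ++ [d]) θ) := by
  simp [Kb, notMem_badPairs_iff hd]

theorem exists_cfWord_eq_of_mem_Kb {w : List ℕ} {d : ℕ} (hd : d = 1 ∨ d = 2)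
    (hw : ∀ a ∈ w ++ [d], 1 ≤ a) {x : ℝ} (hx : x ∈ Kb (w ++ [d])) :
    ∃ y, phi / 3 ≤ y ∧ y ≤ phi ∧ x = cfWord (w ++ [d]) y := by
  obtain ⟨θ, hθ, h4, rfl⟩ := (mem_Kb_append hd).1 hx
  exact ⟨cfVal θ, phi_div_three_le_cfVal hθ h4, cfVal_le_phi hθ,
    cfVal_app hw (one_le_of_mem_Dset hθ)⟩

theorem cfWord_phi_mem_Kb {w : List ℕ} {d : ℕ} (hd : d = 1 ∨ d = 2)
    (hw : ∀ a ∈ w ++ [d], 1 ≤ a) : cfWord (w ++ [d]) phi ∈ Kb (w ++ [d]) :=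
  (mem_Kb_append hd).2 ⟨per13, per13_mem, by simp [per13],
    (cfVal_app hw (one_le_of_mem_Dset per13_mem)).symm⟩

theorem cfWord_phi_div_three_mem_Kb {w : List ℕ} {d : ℕ} (hd : d = 1 ∨ d = 2)
    (hw : ∀ a ∈ w ++ [d], 1 ≤ a) : cfWord (w ++ [d]) (phi / 3) ∈ Kb (w ++ [d]) :=
  (mem_Kb_append hd).2 ⟨per31, per31_mem, by simp [per31], by
    rw [cfVal_app hw (one_le_of_mem_Dset per31_mem), cfVal_per31]⟩

theorem isLeast_Kb_of_even {w : List ℕ} {d : ℕ} (hd : d = 1 ∨ d = 2) (hw : ∀ a ∈ w ++ [d], 1 ≤ a)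
    (he : Even (w ++ [d]).length) : IsLeast (Kb (w ++ [d])) (cfWord (w ++ [d]) (phi / 3)) := by
  refine ⟨cfWord_phi_div_three_mem_Kb hd hw, fun x hx => ?_⟩
  obtain ⟨y, h1, h2, rfl⟩ := exists_cfWord_eq_of_mem_Kb hd hw hx
  exact cfWord_mono hw he (by linarith [phi_nonneg]) h1

theorem isGreatest_Kb_of_even {w : List ℕ} {d : ℕ} (hd : d = 1 ∨ d = 2)
    (hw : ∀ a ∈ w ++ [d], 1 ≤ a) (he : Even (w ++ [d]).length) :
    IsGreatest (Kb (w ++ [d])) (cfWord (w ++ [d]) phi) := by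
  refine ⟨cfWord_phi_mem_Kb hd hw, fun x hx => ?_⟩
  obtain ⟨y, h1, h2, rfl⟩ := exists_cfWord_eq_of_mem_Kb hd hw hx
  exact cfWord_mono hw he (by linarith [phi_nonneg]) h2

theorem isLeast_Kb_of_odd {w : List ℕ} {d : ℕ} (hd : d = 1 ∨ d = 2) (hw : ∀ a ∈ w ++ [d], 1 ≤ a)
    (ho : Odd (w ++ [d]).length) : IsLeast (Kb (w ++ [d])) (cfWord (w ++ [d]) phi) := by
  refine ⟨cfWord_phi_mem_Kb hd hw, fun x hx => ?_⟩
  obtain ⟨y, h1, h2, rfl⟩ := exists_cfWord_eq_of_mem_Kb hd hw hx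
  exact cfWord_anti hw ho (by linarith [phi_nonneg]) h2

theorem isGreatest_Kb_of_odd {w : List ℕ} {d : ℕ} (hd : d = 1 ∨ d = 2)
    (hw : ∀ a ∈ w ++ [d], 1 ≤ a) (ho : Odd (w ++ [d]).length) :
    IsGreatest (Kb (w ++ [d])) (cfWord (w ++ [d]) (phi / 3)) := by
  refine ⟨cfWord_phi_div_three_mem_Kb hd hw, fun x hx => ?_⟩
  obtain ⟨y, h1, h2, rfl⟩ := exists_cfWord_eq_of_mem_Kb hd hw hx
  exact cfWord_anti hw ho (by linarith [phi_nonneg]) h1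

theorem bridge_mem_of_block {w : List ℕ} {d : ℕ} (hd : d = 1 ∨ d = 2) (hw : ∀ a ∈ w ++ [d], 1 ≤ a)
    {S : Set ℕ} (hS : 4 ∉ S) {y₀ y₁ y₂ y₃ : ℝ} (h : Block S y₀ y₁ y₂ y₃) :
    (cfWord (w ++ [d]) y₀, cfWord (w ++ [d]) y₁, cfWord (w ++ [d]) y₂, cfWord (w ++ [d]) y₃) ∈
      bridges (Kb (w ++ [d])) :=
  ⟨_, hw, S, _, _, _, _, h, fun θ hθ h0 => (mem_Kb_append hd).2
    ⟨θ, hθ, fun h4 => hS (h4 ▸ h0), rfl⟩, rfl⟩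

/-! ### Comparison of the pieces after a common prefix -/

theorem near_linear_fractional {x x₀ y₀ : ℝ} (p q r s : ℝ) (hx : Near x x₀)
    (hpos : 1 / 10 ^ 6 ≤ x₀ ∧ 0 < r ∧ 0 ≤ s)
    (hl : (y₀ - 1 / 10 ^ 6) * (r + s * (x₀ - 1 / 10 ^ 6)) ≤ p + q * (x₀ - 1 / 10 ^ 6) ∧
      (y₀ - 1 / 10 ^ 6) * (r + s * (x₀ + 1 / 10 ^ 6)) ≤ p + q * (x₀ + 1 / 10 ^ 6))
    (hu : p + q * (x₀ - 1 / 10 ^ 6) ≤ (y₀ + 1 / 10 ^ 6) * (r + s * (x₀ - 1 / 10 ^ 6)) ∧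
      p + q * (x₀ + 1 / 10 ^ 6) ≤ (y₀ + 1 / 10 ^ 6) * (r + s * (x₀ + 1 / 10 ^ 6))) :
    Near ((p + q * x) / (r + s * x)) y₀ := by
  obtain ⟨h0, hr, hs⟩ := hpos
  obtain ⟨h1, h2⟩ := hx
  have hx0 : 0 ≤ x := by linarith
  have affine : ∀ α β : ℝ, 0 ≤ α + β * (x₀ - 1 / 10 ^ 6) → 0 ≤ α + β * (x₀ + 1 / 10 ^ 6) →
      0 ≤ α + β * x := fun α β h h' => by
    rcases le_total 0 β with hβ | hβ <;> nlinarith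
  constructor
  · rw [le_div_iff₀ (by positivity)]
    have := affine (p - (y₀ - 1 / 10 ^ 6) * r) (q - (y₀ - 1 / 10 ^ 6) * s) (by linarith)
      (by linarith)
    linarith
  · rw [div_le_iff₀ (by positivity)]
    have := affine ((y₀ + 1 / 10 ^ 6) * r - p) ((y₀ + 1 / 10 ^ 6) * s - q) (by linarith)
      (by linarith)
    linarith

theorem cfWord_one_four_one {x : ℝ} (hx : 0 ≤ x) :
    cfWord [1, 4, 1] x = (5 + 4 * x) / (6 + 5 * x) := by
  simp only [cfWord_cons, cfWord_nil]
  push_cast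
  field_simp
  ring

theorem cfWord_one_three_one {x : ℝ} (hx : 0 ≤ x) :
    cfWord [1, 3, 1] x = (4 + 3 * x) / (5 + 4 * x) := by
  simp only [cfWord_cons, cfWord_nil]
  push_cast
  field_simp
  ring

theorem near_one_four_one_phi :
    Near (cfWord [1, 4, 1] phi) 0.8200875 := by
  rw [cfWord_one_four_one (by linarith [near_phi.1])]
  exact near_linear_fractional _ _ _ _ near_phi (by norm_num) (by norm_num) (by norm_num)

theorem near_one_four_one_min_one :
    Near (cfWord [1, 4, 1] ((phi + 2) / 5)) 0.8227498 := by
  rw [cfWord_one_four_one (by linarith [near_min_one.1])]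
  exact near_linear_fractional _ _ _ _ near_min_one (by norm_num) (by norm_num) (by norm_num)

theorem near_one_four_one_min_two :
    Near (cfWord [1, 4, 1] ((phi + 1) / 5)) 0.8256697 := by
  rw [cfWord_one_four_one (by linarith [near_min_two.1])]
  exact near_linear_fractional _ _ _ _ near_min_two (by norm_num) (by norm_num) (by norm_num)

theorem near_one_four_one_max_two :
    Near (cfWord [1, 4, 1] ((3 - phi) / 5)) 0.8243644 := by
  rw [cfWord_one_four_one (by linarith [near_max_two.1])]
  exact near_linear_fractional _ _ _ _ near_max_two (by norm_num) (by norm_num) (by norm_num)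

theorem near_one_four_one_one_max_two :
    Near (cfWord [1, 4, 1] (1 / (((1 : ℕ) : ℝ) + (3 - phi) / 5))) 0.8211237 := by
  rw [cfWord_one_four_one (by linarith [near_one_max_two.1])]
  exact near_linear_fractional _ _ _ _ near_one_max_two (by norm_num) (by norm_num) (by norm_num)

theorem near_one_four_one_one_min_one :
    Near (cfWord [1, 4, 1] (1 / (((1 : ℕ) : ℝ) + (phi + 2) / 5))) 0.8217186 := by
  rw [cfWord_one_four_one (by linarith [near_one_min_one.1])]
  exact near_linear_fractional _ _ _ _ near_one_min_one (by norm_num) (by norm_num) (by norm_num)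

theorem near_one_four_one_two_max_two :
    Near (cfWord [1, 4, 1] (1 / (((2 : ℕ) : ℝ) + (3 - phi) / 5))) 0.8248518 := by
  rw [cfWord_one_four_one (by linarith [near_two_max_two.1])]
  exact near_linear_fractional _ _ _ _ near_two_max_two (by norm_num) (by norm_num) (by norm_num)

theorem near_one_four_one_two_min_one :
    Near (cfWord [1, 4, 1] (1 / (((2 : ℕ) : ℝ) + (phi + 2) / 5))) 0.8251431 := by
  rw [cfWord_one_four_one (by linarith [near_two_min_one.1])]
  exact near_linear_fractional _ _ _ _ near_two_min_one (by norm_num) (by norm_num) (by norm_num)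

theorem near_one_three_one_phi :
    Near (cfWord [1, 3, 1] phi) 0.7806179 := by
  rw [cfWord_one_three_one (by linarith [near_phi.1])]
  exact near_linear_fractional _ _ _ _ near_phi (by norm_num) (by norm_num) (by norm_num)

theorem near_one_three_one_min_one :
    Near (cfWord [1, 3, 1] ((phi + 2) / 5)) 0.7845637 := by
  rw [cfWord_one_three_one (by linarith [near_min_one.1])]
  exact near_linear_fractional _ _ _ _ near_min_one (by norm_num) (by norm_num) (by norm_num)

theorem near_one_three_one_min_two :
    Near (cfWord [1, 3, 1] ((phi + 1) / 5)) 0.7888619 := by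
  rw [cfWord_one_three_one (by linarith [near_min_two.1])]
  exact near_linear_fractional _ _ _ _ near_min_two (by norm_num) (by norm_num) (by norm_num)

theorem near_one_three_one_max_two :
    Near (cfWord [1, 3, 1] ((3 - phi) / 5)) 0.7869442 := by
  rw [cfWord_one_three_one (by linarith [near_max_two.1])]
  exact near_linear_fractional _ _ _ _ near_max_two (by norm_num) (by norm_num) (by norm_num)

theorem near_one_three_one_max_three :
    Near (cfWord [1, 3, 1] ((7 + phi) / 25)) 0.7900217 := by
  rw [cfWord_one_three_one (by linarith [near_max_three.1])]
  exact near_linear_fractional _ _ _ _ near_max_three (by norm_num) (by norm_num) (by norm_num)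

theorem near_one_three_one_phi_div_three :
    Near (cfWord [1, 3, 1] (phi / 3)) 0.7912878 := by
  rw [cfWord_one_three_one (by linarith [near_phi_div_three.1])]
  exact near_linear_fractional _ _ _ _ near_phi_div_three (by norm_num) (by norm_num) (by norm_num)

theorem gap_b_one_le {u : List ℕ} (hu : ∀ a ∈ u, 1 ≤ a) :
    |cfWord u (cfWord [1, 4, 1] (1 / (((1 : ℕ) : ℝ) + (phi + 2) / 5))) -
        cfWord u (cfWord [1, 4, 1] (1 / (((1 : ℕ) : ℝ) + (3 - phi) / 5)))| ≤
      1 * |cfWord u (cfWord [1, 3, 1] (phi / 3)) -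
        cfWord u (cfWord [1, 3, 1] phi)| :=
  abs_cfWord_sub_le_of_near hu _ _ _ _ _ near_one_three_one_phi near_one_three_one_phi_div_three
    near_one_four_one_one_max_two near_one_four_one_one_min_one (by norm_num) (by norm_num)

theorem gap_c_le {u : List ℕ} (hu : ∀ a ∈ u, 1 ≤ a) :
    |cfWord u (cfWord [1, 3, 1] ((3 - phi) / 5)) -
        cfWord u (cfWord [1, 3, 1] ((phi + 2) / 5))| ≤
      (99 / 100) * |cfWord u (cfWord [1, 4, 1] ((phi + 2) / 5)) -
        cfWord u (cfWord [1, 4, 1] phi)| :=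
  abs_cfWord_sub_le_of_near hu _ _ _ _ _ near_one_four_one_phi near_one_four_one_min_one
    near_one_three_one_min_one near_one_three_one_max_two (by norm_num) (by norm_num)

theorem gap_b_two_le {u : List ℕ} (hu : ∀ a ∈ u, 1 ≤ a) :
    |cfWord u (cfWord [1, 4, 1] (1 / (((2 : ℕ) : ℝ) + (phi + 2) / 5))) -
        cfWord u (cfWord [1, 4, 1] (1 / (((2 : ℕ) : ℝ) + (3 - phi) / 5)))| ≤
      1 * |cfWord u (cfWord [1, 3, 1] (phi / 3)) -
        cfWord u (cfWord [1, 3, 1] ((3 - phi) / 5))| :=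
  abs_cfWord_sub_le_of_near hu _ _ _ _ _ near_one_three_one_max_two near_one_three_one_phi_div_three
    near_one_four_one_two_max_two near_one_four_one_two_min_one (by norm_num) (by norm_num)

theorem gap_c_two_three_le {u : List ℕ} (hu : ∀ a ∈ u, 1 ≤ a) :
    |cfWord u (cfWord [1, 3, 1] ((7 + phi) / 25)) -
        cfWord u (cfWord [1, 3, 1] ((phi + 1) / 5))| ≤
      1 * |cfWord u (cfWord [1, 4, 1] ((phi + 1) / 5)) -
        cfWord u (cfWord [1, 4, 1] ((3 - phi) / 5))| :=
  abs_cfWord_sub_le_of_near hu _ _ _ _ _ near_one_four_one_max_two near_one_four_one_min_two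
    near_one_three_one_min_two near_one_three_one_max_three (by norm_num) (by norm_num)

theorem gap_b_le {u : List ℕ} (hu : ∀ a ∈ u, 1 ≤ a) :
    |cfWord u (cfWord [1, 4, 1] ((3 - phi) / 5)) -
        cfWord u (cfWord [1, 4, 1] ((phi + 2) / 5))| ≤
      1 * |cfWord u (cfWord [1, 3, 1] (phi / 3)) -
        cfWord u (cfWord [1, 3, 1] ((3 - phi) / 5))| :=
  abs_cfWord_sub_le_of_near hu _ _ _ _ _ near_one_three_one_max_two near_one_three_one_phi_div_three
    near_one_four_one_min_one near_one_four_one_max_two (by norm_num) (by norm_num)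

theorem exists_sub_mem_uIcc {a b a' b' t : ℝ} (h : a ≤ b) (h' : a' ≤ b') (h₁ : a + a' ≤ t)
    (h₂ : t ≤ b + b') : ∃ x ∈ uIcc a b, t - x ∈ uIcc a' b' := by
  rw [uIcc_of_le h, uIcc_of_le h']
  refine ⟨max a (t - b'), ⟨le_max_left _ _, max_le h (by linarith)⟩, ?_, ?_⟩
  · rcases max_cases a (t - b') with ⟨h, -⟩ | ⟨h, -⟩ <;> rw [h] <;> linarith
  · linarith [le_max_right a (t - b')]

theorem length_bW (s : ℕ) : (bW s).length = 2 * s := by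
  simp [bW, mul_comm]

theorem one_le_of_mem_bW {s a : ℕ} (h : a ∈ bW s) : 1 ≤ a := by
  simp [bW] at h
  omega

theorem bW_succ (s : ℕ) : bW (s + 1) = bW s ++ [1, 4] := by
  simp [bW, List.replicate_succ']

theorem min_b_one_lt_max_b_one {u : List ℕ} (hu : ∀ a ∈ u, 1 ≤ a) (he : Even u.length) :
    cfWord u (cfWord [1, 4, 1] phi) < cfWord u (cfWord [1, 4, 1] ((phi + 2) / 5)) := by
  have h₁ := near_one_four_one_phi
  have h₂ := near_one_four_one_min_one
  norm_num [Near] at h₁ h₂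
  exact cfWord_strictMono hu he (by linarith) (by linarith)

theorem max_b_one_le_min_b_two {u : List ℕ} (hu : ∀ a ∈ u, 1 ≤ a) (he : Even u.length) :
    cfWord u (cfWord [1, 4, 1] ((phi + 2) / 5)) ≤ cfWord u (cfWord [1, 4, 1] ((3 - phi) / 5)) := by
  have h₁ := near_one_four_one_min_one
  have h₂ := near_one_four_one_max_two
  norm_num [Near] at h₁ h₂
  exact cfWord_mono hu he (by linarith) (by linarith)

theorem min_b_two_le_max_b_two {u : List ℕ} (hu : ∀ a ∈ u, 1 ≤ a) (he : Even u.length) :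
    cfWord u (cfWord [1, 4, 1] ((3 - phi) / 5)) ≤ cfWord u (cfWord [1, 4, 1] ((phi + 1) / 5)) := by
  have h₁ := near_one_four_one_max_two
  have h₂ := near_one_four_one_min_two
  norm_num [Near] at h₁ h₂
  exact cfWord_mono hu he (by linarith) (by linarith)

theorem min_c_le_min_c_two {u : List ℕ} (hu : ∀ a ∈ u, 1 ≤ a) (he : Even u.length) :
    cfWord u (cfWord [1, 3, 1] phi) ≤ cfWord u (cfWord [1, 3, 1] ((3 - phi) / 5)) := by
  have h₁ := near_one_three_one_phi
  have h₂ := near_one_three_one_max_two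
  norm_num [Near] at h₁ h₂
  exact cfWord_mono hu he (by linarith) (by linarith)

theorem min_c_two_le_max_c {u : List ℕ} (hu : ∀ a ∈ u, 1 ≤ a) (he : Even u.length) :
    cfWord u (cfWord [1, 3, 1] ((3 - phi) / 5)) ≤ cfWord u (cfWord [1, 3, 1] (phi / 3)) := by
  have h₁ := near_one_three_one_max_two
  have h₂ := near_one_three_one_phi_div_three
  norm_num [Near] at h₁ h₂
  exact cfWord_mono hu he (by linarith) (by linarith)

theorem cfWord_append_singleton (u v : List ℕ) (j : ℕ) (x : ℝ) :
    cfWord ((u ++ v) ++ [j]) x = cfWord u (cfWord v (1 / (j + x))) := by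
  simp only [cfWord_append, cfWord_cons, cfWord_nil]

/-- The sets `K(u,1,4,1,1)` and `K(u,1,4,1,2)` overlap `K(u,1,3,1)` well enough for the sums to
cover the whole interval between the extreme sums. -/
theorem Icc_subset_union_add {u : List ℕ} (hu : ∀ a ∈ u, 1 ≤ a) (he : Even u.length) :
    Icc (cfWord u (cfWord [1, 4, 1] phi) + cfWord u (cfWord [1, 3, 1] phi))
        (cfWord u (cfWord [1, 4, 1] ((phi + 1) / 5)) + cfWord u (cfWord [1, 3, 1] (phi / 3))) ⊆
      (Kb ((u ++ [1, 4, 1]) ++ [1]) ∪ Kb ((u ++ [1, 4, 1]) ++ [2])) + Kb ((u ++ [1, 3]) ++ [1]) := by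
  have hb : ∀ j ∈ ({1, 2} : Set ℕ), ∀ a ∈ (u ++ [1, 4, 1]) ++ [j], 1 ≤ a := by
    intro j hj a ha
    simp only [mem_insert_iff, mem_singleton_iff] at hj
    simp only [List.mem_append, List.mem_cons, List.not_mem_nil, or_false] at ha
    rcases ha with (ha | ha) | ha
    exacts [hu a ha, by omega, by omega]
  have hc : ∀ a ∈ (u ++ [1, 3]) ++ [1], 1 ≤ a := by
    intro a ha
    simp only [List.mem_append, List.mem_cons, List.not_mem_nil, or_false] at ha
    rcases ha with (ha | ha) | ha
    exacts [hu a ha, by omega, by omega]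
  have hb₁ := hb 1 (by simp)
  have hb₂ := hb 2 (by simp)
  have bridge_b_one := bridge_mem_of_block (.inl rfl) hb₁ (by simp) Block.b123
  have bridge_b_two := bridge_mem_of_block (.inr rfl) hb₂ (by simp) Block.b123
  have bridge_c := bridge_mem_of_block (.inl rfl) hc (by simp) Block.b123
  have bridge_c_right := bridge_mem_of_block (.inl rfl) hc (by simp) Block.b23
  have hcw : ∀ x, cfWord ((u ++ [1, 3]) ++ [1]) x = cfWord u (cfWord [1, 3, 1] x) := fun x => by
    simp only [cfWord_append, cfWord_cons, cfWord_nil]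
  simp only [cfWord_append_singleton u [1, 4, 1], ← min_letter_one, ← max_letter_one,
    ← min_letter_two, ← max_letter_two] at bridge_b_one bridge_b_two
  simp only [hcw] at bridge_c bridge_c_right
  rintro t ⟨h₁, h₂⟩
  have h01 := (min_b_one_lt_max_b_one hu he).le
  have h12 := max_b_one_le_min_b_two hu he
  have h23 := min_b_two_le_max_b_two hu he
  have c02 := min_c_le_min_c_two hu he
  have c24 := min_c_two_le_max_c hu he
  have gap_b := gap_b_le hu
  rw [abs_of_nonneg (sub_nonneg.2 h12), abs_of_nonneg (sub_nonneg.2 c24), one_mul] at gap_b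
  rcases le_total t (cfWord u (cfWord [1, 4, 1] ((phi + 2) / 5)) +
    cfWord u (cfWord [1, 3, 1] (phi / 3))) with ht | ht
  · refine add_subset_add_right subset_union_left
      (Icc_subset_add (isCompact_Kb hb₁) (isCompact_Kb hc) (isBridgeSystem_bridges _)
        (isBridgeSystem_bridges _) bridge_b_one bridge_c ?_ ?_ ?_)
    · simpa only [one_mul, abs_sub_comm (cfWord u (cfWord [1, 3, 1] phi))] using gap_b_one_le hu
    · rw [abs_sub_comm]
      exact (gap_c_le hu).trans (mul_le_of_le_one_left (abs_nonneg _) (by norm_num))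
    · rw [uIcc_comm (cfWord u (cfWord [1, 3, 1] (phi / 3)))]
      exact exists_sub_mem_uIcc h01 (c02.trans c24) h₁ ht
  · refine add_subset_add_right subset_union_right
      (Icc_subset_add (isCompact_Kb hb₂) (isCompact_Kb hc) (isBridgeSystem_bridges _)
        (isBridgeSystem_bridges _) bridge_b_two bridge_c_right ?_ ?_ ?_)
    · rw [abs_sub_comm (cfWord u (cfWord [1, 3, 1] ((3 - phi) / 5)))]
      simpa only [one_mul] using gap_b_two_le hu
    · rw [abs_sub_comm (cfWord u (cfWord [1, 3, 1] ((phi + 1) / 5)))]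
      simpa only [one_mul] using gap_c_two_three_le hu
    · rw [uIcc_comm (cfWord u (cfWord [1, 3, 1] (phi / 3)))]
      exact exists_sub_mem_uIcc h23 c24 (by linarith) h₂

/-- For every `s ≥ 1`:
`max K(b^s,1,2) + max K(c^s,1,1) > min K(b^s,1,1) + min K(c^s,1,2)`, and
consequently `(K(b^s,1,1) ∪ K(b^s,1,2)) + K(c^s,1)` is the closed interval
`[[0; b^s,1,1,\overline{3,1}] + [0; c^s,1,\overline{1,3}],
  [0; b^s,1,2,\overline{1,3}] + [0; c^s,1,\overline{3,1}]]`. -/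
theorem sum_Kbs1p_Kcs1 (s : ℕ) (hs : 1 ≤ s) :
    sSup (Kb (bW s ++ [1, 2])) + sSup (Kb (cW s ++ [1, 1])) >
      sInf (Kb (bW s ++ [1, 1])) + sInf (Kb (cW s ++ [1, 2])) ∧
    (Kb (bW s ++ [1, 1]) ∪ Kb (bW s ++ [1, 2])) + Kb (cW s ++ [1]) =
      Set.Icc
        (cfVal (app (bW s ++ [1, 1]) per31) + cfVal (app (cW s ++ [1]) per13))
        (cfVal (app (bW s ++ [1, 2]) per13) + cfVal (app (cW s ++ [1]) per31)) := by
  obtain ⟨m, rfl⟩ := Nat.exists_eq_add_of_le' hs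
  have hu : ∀ a ∈ bW m, 1 ≤ a := fun a => one_le_of_mem_bW
  have he : Even (bW m).length := by simp [length_bW]
  have hcW : cW (m + 1) = bW m ++ [1, 3] := rfl
  have hmem : ∀ v : List ℕ, (∀ a ∈ v, 1 ≤ a) → ∀ a ∈ bW m ++ v, 1 ≤ a := fun v hv a ha =>
    (List.mem_append.1 ha).elim (hu a) (hv a)
  have hb₁ : bW (m + 1) ++ [1, 1] = (bW m ++ [1, 4, 1]) ++ [1] := by simp [bW_succ]
  have hb₂ : bW (m + 1) ++ [1, 2] = (bW m ++ [1, 4, 1]) ++ [2] := by simp [bW_succ]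
  have hc₁ : cW (m + 1) ++ [1, 1] = (bW m ++ [1, 3, 1]) ++ [1] := by simp [hcW]
  have hc₂ : cW (m + 1) ++ [1, 2] = (bW m ++ [1, 3, 1]) ++ [2] := by simp [hcW]
  have pb₁ : ∀ a ∈ (bW m ++ [1, 4, 1]) ++ [1], 1 ≤ a := by
    rw [List.append_assoc]; exact hmem _ (by simp)
  have pb₂ : ∀ a ∈ (bW m ++ [1, 4, 1]) ++ [2], 1 ≤ a := by
    rw [List.append_assoc]; exact hmem _ (by simp)
  have pc : ∀ a ∈ (bW m ++ [1, 3]) ++ [1], 1 ≤ a := by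
    rw [List.append_assoc]; exact hmem _ (by simp)
  have pc₁ : ∀ a ∈ (bW m ++ [1, 3, 1]) ++ [1], 1 ≤ a := by
    rw [List.append_assoc]; exact hmem _ (by simp)
  have pc₂ : ∀ a ∈ (bW m ++ [1, 3, 1]) ++ [2], 1 ≤ a := by
    rw [List.append_assoc]; exact hmem _ (by simp)
  have even_length : ∀ i j k l : ℕ, Even ((bW m ++ [i, j, k]) ++ [l]).length := fun i j k l => by
    simp [length_bW, Nat.even_add, show Even 4 from ⟨2, rfl⟩, parity_simps]
  have odd_length : Odd ((bW m ++ [1, 3]) ++ [1]).length := by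
    simp [length_bW, parity_simps]
  have hcw : ∀ x, cfWord ((bW m ++ [1, 3]) ++ [1]) x = cfWord (bW m) (cfWord [1, 3, 1] x) :=
    fun x => by simp only [cfWord_append, cfWord_cons, cfWord_nil]
  have b_one_least := isLeast_Kb_of_even (.inl rfl) pb₁ (even_length 1 4 1 1)
  have b_one_greatest := isGreatest_Kb_of_even (.inl rfl) pb₁ (even_length 1 4 1 1)
  have b_two_least := isLeast_Kb_of_even (.inr rfl) pb₂ (even_length 1 4 1 2)
  have b_two_greatest := isGreatest_Kb_of_even (.inr rfl) pb₂ (even_length 1 4 1 2)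
  have c_least := isLeast_Kb_of_odd (.inl rfl) pc odd_length
  have c_greatest := isGreatest_Kb_of_odd (.inl rfl) pc odd_length
  have c_one_greatest := isGreatest_Kb_of_even (.inl rfl) pc₁ (even_length 1 3 1 1)
  have c_two_least := isLeast_Kb_of_even (.inr rfl) pc₂ (even_length 1 3 1 2)
  simp only [cfWord_append_singleton (bW m) [1, 4, 1], cfWord_append_singleton (bW m) [1, 3, 1],
    ← min_letter_one, ← max_letter_one, ← min_letter_two, ← max_letter_two, hcw]
    at b_one_least b_one_greatest b_two_least b_two_greatest c_least c_greatest c_one_greatest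
      c_two_least
  have h01 := min_b_one_lt_max_b_one hu he
  have h12 := max_b_one_le_min_b_two hu he
  have h23 := min_b_two_le_max_b_two hu he
  constructor
  · rw [hb₁, hb₂, hc₁, hc₂, b_two_greatest.csSup_eq, c_one_greatest.csSup_eq,
      b_one_least.csInf_eq, c_two_least.csInf_eq]
    have gap := (le_abs_self _).trans (gap_c_le hu)
    rw [abs_of_pos (sub_pos.2 h01)] at gap
    linarith
  · rw [hb₁, hb₂, hcW, cfVal_app pb₁ (one_le_of_mem_Dset per31_mem),
      cfVal_app pb₂ (one_le_of_mem_Dset per13_mem), cfVal_app pc (one_le_of_mem_Dset per31_mem),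
      cfVal_app pc (one_le_of_mem_Dset per13_mem), cfVal_per31, ← phi]
    simp only [cfWord_append_singleton (bW m) [1, 4, 1], ← max_letter_one, ← min_letter_two, hcw]
    refine Subset.antisymm ?_ (Icc_subset_union_add hu he)
    rintro _ ⟨x, hx | hx, y, hy, rfl⟩
    · exact ⟨add_le_add (b_one_least.2 hx) (c_least.2 hy),
        add_le_add ((b_one_greatest.2 hx).trans (h12.trans h23)) (c_greatest.2 hy)⟩
    · exact ⟨add_le_add ((h01.le.trans h12).trans (b_two_least.2 hx)) (c_least.2 hy),
        add_le_add (b_two_greatest.2 hx) (c_greatest.2 hy)⟩
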